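/- arXiv:1803.00099 — 2 statements merged into one kernel-verified Lean document; each statement's English description precedes it below -/
import Mathlib

section
/- For every d ≥ 1, n ≥ 1, k ∈ {1,…,d} and r ∈ ℕ, the Monte Carlo method Ā_{n,k,r} satisfies the worst-case expected error bound sup_{f∈F_mon^d} E‖Ā_{n,k,r}(f) − f‖_{L1} ≤ 5·d/2^r + 4·√(d·r)/(k+1) + 4·exp[k(1 + log(d/k) + (log 2)·r)]/n. -/
open MeasureTheory
open scoped ENNReal NNReal

noncomputable section

/-- The unit cube `[0,1]^d`. -/
def unitCube (d : ℕ) : Set (Fin d → ℝ) := Set.Icc 0 1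

/-- The class of monotone functions `f : [0,1]^d → [-1,1]`. -/
def FMon (d : ℕ) : Set ((Fin d → ℝ) → ℝ) :=
  {f | (∀ x ∈ unitCube d, f x ∈ Set.Icc (-1 : ℝ) 1) ∧
       (∀ x ∈ unitCube d, ∀ y ∈ unitCube d, x ≤ y → f x ≤ f y)}

/-- The class of sign-valued monotone functions `f : [0,1]^d → {-1,+1}`. -/
def FMonPM (d : ℕ) : Set ((Fin d → ℝ) → ℝ) :=
  {f | f ∈ FMon d ∧ ∀ x ∈ unitCube d, f x = -1 ∨ f x = 1}

/-- The (extended-real-valued) `L₁([0,1]^d)` distance between two functions. -/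
def dist1e {d : ℕ} (g f : (Fin d → ℝ) → ℝ) : ℝ≥0∞ :=
  ∫⁻ x in unitCube d, ENNReal.ofReal |g x - f x|

/-- The dyadic interval `I_{λ,κ} = [κ2^{-λ}, (κ+1)2^{-λ})`, closed at the right end
for the last one (`κ = 2^λ - 1`). -/
def dyadicI (lam kap : ℕ) : Set ℝ :=
  if kap + 1 = 2 ^ lam then Set.Icc ((kap : ℝ) / 2 ^ lam) 1
  else Set.Ico ((kap : ℝ) / 2 ^ lam) (((kap : ℝ) + 1) / 2 ^ lam)

/-- One-dimensional Haar functions: `ψ₀ = 1_{[0,1]}` and, for `α = 2^λ + κ ≥ 1`,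
`ψ_α = 2^{λ/2}(1_{I_{λ+1,2κ+1}} - 1_{I_{λ+1,2κ}})`. -/
def haar1 (α : ℕ) : ℝ → ℝ :=
  if α = 0 then (Set.Icc (0 : ℝ) 1).indicator 1
  else fun x =>
    Real.sqrt (2 ^ Nat.log 2 α) *
      ((dyadicI (Nat.log 2 α + 1) (2 * (α - 2 ^ Nat.log 2 α) + 1)).indicator 1 x -
        (dyadicI (Nat.log 2 α + 1) (2 * (α - 2 ^ Nat.log 2 α))).indicator 1 x)

/-- The tensor-product Haar function `ψ_α(x) = ∏_j ψ_{α_j}(x_j)`. -/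
def haar {d : ℕ} (α : Fin d → ℕ) (x : Fin d → ℝ) : ℝ :=
  ∏ j, haar1 (α j) (x j)

/-- The Haar wavelet coefficient `f̃(α) = ⟨ψ_α, f⟩`. -/
def wcoef {d : ℕ} (f : (Fin d → ℝ) → ℝ) (α : Fin d → ℕ) : ℝ :=
  ∫ x in unitCube d, haar α x * f x

/-- The number of active variables `|α|₀ = #{j : α_j > 0}`. -/
def activeCount {d : ℕ} (α : Fin d → ℕ) : ℕ :=
  (Finset.univ.filter (fun j => α j ≠ 0)).card

/-- The sign function, with the convention `sgn 0 = 1`. -/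
def sgn (t : ℝ) : ℝ := if 0 ≤ t then 1 else -1

/-- The truncated Haar expansion `f_r = Σ_{α : λ(α) < r} f̃(α) ψ_α`; the indices `α ∈ ℕ₀`
of level `< r` are exactly those with `α < 2^r`. -/
def truncExp {d : ℕ} (f : (Fin d → ℝ) → ℝ) (r : ℕ) : (Fin d → ℝ) → ℝ :=
  fun x => ∑ α : Fin d → Fin (2 ^ r),
    wcoef f (fun j => (α j : ℕ)) * haar (fun j => (α j : ℕ)) x

/-- The distribution of `n` i.i.d. points uniformly distributed on `[0,1]^d`. -/
def sampleMeasure (d n : ℕ) : Measure (Fin n → (Fin d → ℝ)) :=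
  Measure.pi (fun _ => volume.restrict (unitCube d))

/-- The linear reconstruction `A_{n,k,r}`: all Haar coefficients with at most `k` active
variables and level `< r` are estimated by standard Monte Carlo from the samples
`ξ_1, …, ξ_n`. -/
def linAlg (d n k r : ℕ) (ξ : Fin n → (Fin d → ℝ)) (f : (Fin d → ℝ) → ℝ) :
    (Fin d → ℝ) → ℝ :=
  fun x => ∑ α ∈ Finset.univ.filter
      (fun α : Fin d → Fin (2 ^ r) => activeCount (fun j => (α j : ℕ)) ≤ k),
    ((n : ℝ)⁻¹ * ∑ i, haar (fun j => (α j : ℕ)) (ξ i) * f (ξ i)) *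
      haar (fun j => (α j : ℕ)) x

/-- The sign-valued reconstruction `Â_{n,k,r} = sgn ∘ A_{n,k,r}`. -/
def hatAlg (d n k r : ℕ) (ξ : Fin n → (Fin d → ℝ)) (f : (Fin d → ℝ) → ℝ) :
    (Fin d → ℝ) → ℝ :=
  fun x => sgn (linAlg d n k r ξ f x)

/-- The general method `Ā_{n,k,r}(f) = (1/2)∫_{-1}^{1} Â_{n,k,r}(f_t) dt`, where
`f_t = sgn(f - t)`. -/
def barAlg (d n k r : ℕ) (ξ : Fin n → (Fin d → ℝ)) (f : (Fin d → ℝ) → ℝ) :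
    (Fin d → ℝ) → ℝ :=
  fun x => (1 / 2) * ∫ t in (-1 : ℝ)..1, hatAlg d n k r ξ (fun y => sgn (f y - t)) x

/-- The values of the one-dimensional Haar function with index `a` on the dyadic cells of
level `r`. -/
def cellHaar (r a i : ℕ) : ℝ :=
  if a = 0 then 1
  else Real.sqrt (2 ^ Nat.log 2 a) *
    ((if i / 2 ^ (r - (Nat.log 2 a + 1)) = 2 * (a - 2 ^ Nat.log 2 a) + 1 then 1 else 0) -
      (if i / 2 ^ (r - (Nat.log 2 a + 1)) = 2 * (a - 2 ^ Nat.log 2 a) then 1 else 0))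

@[simp] lemma cellHaar_zero (r i : ℕ) : cellHaar r 0 i = 1 := by simp [cellHaar]

lemma log_two_pow_add {l κ : ℕ} (h : κ < 2 ^ l) : Nat.log 2 (2 ^ l + κ) = l := by
  rw [Nat.log_eq_iff (by right; constructor <;> [norm_num; positivity])]
  constructor
  · omega
  · rw [pow_succ]; omega

lemma cellHaar_two_pow_add (r i : ℕ) {l κ : ℕ} (h : κ < 2 ^ l) :
    cellHaar r (2 ^ l + κ) i = Real.sqrt (2 ^ l) *
      ((if i / 2 ^ (r - (l + 1)) = 2 * κ + 1 then 1 else 0) -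
        (if i / 2 ^ (r - (l + 1)) = 2 * κ then 1 else 0)) := by
  have h0 : 2 ^ l + κ ≠ 0 := by positivity
  rw [cellHaar, if_neg h0, log_two_pow_add h, Nat.add_sub_cancel_left]

/-- Sums over `a < 2 ^ r` split into dyadic levels. -/
lemma sum_range_two_pow (φ : ℕ → ℝ) (r : ℕ) :
    ∑ a ∈ Finset.range (2 ^ r), φ a =
      φ 0 + ∑ l ∈ Finset.range r, ∑ κ ∈ Finset.range (2 ^ l), φ (2 ^ l + κ) := by
  induction r with
  | zero => simp
  | succ r ih =>
    rw [Finset.sum_range_succ, ← add_assoc, ← ih, pow_succ, mul_two, Finset.sum_range_add]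

lemma sum_level_cellHaar (r : ℕ) {l i i' : ℕ} (hl : l < r) (hi : i < 2 ^ r) :
    ∑ κ ∈ Finset.range (2 ^ l), cellHaar r (2 ^ l + κ) i * cellHaar r (2 ^ l + κ) i' =
      2 ^ (l + 1) * (if i / 2 ^ (r - (l + 1)) = i' / 2 ^ (r - (l + 1)) then 1 else 0) -
        2 ^ l * (if i / 2 ^ (r - l) = i' / 2 ^ (r - l) then 1 else 0) := by
  have e : ∀ j, j / 2 ^ (r - l) = j / 2 ^ (r - (l + 1)) / 2 := by
    intro j
    rw [Nat.div_div_eq_div_mul, ← pow_succ, show r - (l + 1) + 1 = r - l by omega]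
  have hq : i / 2 ^ (r - (l + 1)) < 2 ^ l * 2 := by
    rw [Nat.div_lt_iff_lt_mul (by positivity), ← pow_succ, ← pow_add,
      show l + 1 + (r - (l + 1)) = r by omega]
    exact hi
  rw [e i, e i']
  generalize hqe : i / 2 ^ (r - (l + 1)) = q at *
  generalize hqe' : i' / 2 ^ (r - (l + 1)) = q' at *
  have key : ∀ κ ∈ Finset.range (2 ^ l),
      cellHaar r (2 ^ l + κ) i * cellHaar r (2 ^ l + κ) i' =
        if κ = q / 2 then 2 ^ l * (2 * (if q = q' then 1 else 0) -
          (if q / 2 = q' / 2 then 1 else 0)) else 0 := by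
    intro κ hκ
    have hs : Real.sqrt ((2 : ℝ) ^ l) * Real.sqrt (2 ^ l) = 2 ^ l :=
      Real.mul_self_sqrt (by positivity)
    rw [cellHaar_two_pow_add _ _ (Finset.mem_range.1 hκ),
      cellHaar_two_pow_add _ _ (Finset.mem_range.1 hκ), hqe, hqe', mul_mul_mul_comm, hs]
    split_ifs <;> first | omega | norm_num
  rw [Finset.sum_congr rfl key, Finset.sum_ite_eq', if_pos (by simp; omega)]
  ring

/-- Completeness of the Haar system up to level `r`. -/
lemma sum_cellHaar_mul (r : ℕ) {i i' : ℕ} (hi : i < 2 ^ r) (hi' : i' < 2 ^ r) :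
    ∑ a ∈ Finset.range (2 ^ r), cellHaar r a i * cellHaar r a i' =
      if i = i' then 2 ^ r else 0 := by
  rw [sum_range_two_pow (fun a => cellHaar r a i * cellHaar r a i')]
  rw [Finset.sum_congr rfl fun l hl => sum_level_cellHaar r (Finset.mem_range.1 hl) hi]
  rw [Finset.sum_range_sub (fun l => (2 : ℝ) ^ l *
    (if i / 2 ^ (r - l) = i' / 2 ^ (r - l) then 1 else 0))]
  simp [Nat.div_eq_of_lt hi, Nat.div_eq_of_lt hi']

/-- Orthonormality of the Haar system up to level `r`. -/
lemma sum_cellHaar_mul_index (r : ℕ) (a b : Fin (2 ^ r)) :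
    ∑ i : Fin (2 ^ r), cellHaar r a i * cellHaar r b i = if a = b then 2 ^ r else 0 := by
  let H : Matrix (Fin (2 ^ r)) (Fin (2 ^ r)) ℝ := Matrix.of fun a i => cellHaar r a i
  have h1 : (((2 : ℝ) ^ r)⁻¹ • H.transpose) * H = 1 := by
    ext i i'
    have := sum_cellHaar_mul r i.2 i'.2
    rw [← Fin.sum_univ_eq_sum_range (fun a => cellHaar r a i * cellHaar r a i')] at this
    simp only [Matrix.smul_apply, Matrix.mul_apply, Matrix.transpose_apply, H,
      Matrix.of_apply, smul_eq_mul, mul_assoc, ← Finset.mul_sum, this, Matrix.one_apply,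
      Fin.val_inj]
    split_ifs <;> simp
  have h2 := congrArg (fun M => M a b) (mul_eq_one_comm.1 h1)
  simp only [Matrix.smul_apply, Matrix.mul_apply, Matrix.transpose_apply, H,
    Matrix.of_apply, smul_eq_mul, mul_left_comm _ ((2 : ℝ) ^ r)⁻¹, ← Finset.mul_sum,
    Matrix.one_apply] at h2
  rw [inv_mul_eq_iff_eq_mul₀ (by positivity)] at h2
  rw [h2]; simp

lemma abs_cellHaar (r a i : ℕ) (ha : a ≠ 0) :
    |cellHaar r a i| = (Real.sqrt (2 ^ Nat.log 2 a))⁻¹ * cellHaar r a i ^ 2 := by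
  have h : 0 < Real.sqrt ((2 : ℝ) ^ Nat.log 2 a) := by positivity
  rw [cellHaar, if_neg ha]
  set s := Real.sqrt ((2 : ℝ) ^ Nat.log 2 a)
  rw [abs_mul, abs_of_pos h]
  split_ifs <;> first | omega | (field_simp; norm_num)

lemma sum_abs_cellHaar (r : ℕ) (a : Fin (2 ^ r)) (ha : (a : ℕ) ≠ 0) :
    ∑ i : Fin (2 ^ r), |cellHaar r a i| = 2 ^ r * (Real.sqrt (2 ^ Nat.log 2 (a : ℕ)))⁻¹ := by
  simp_rw [abs_cellHaar r a _ ha, ← Finset.mul_sum, pow_two]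
  rw [sum_cellHaar_mul_index]; simp [mul_comm]

lemma exists_level {r a : ℕ} (ha : a ≠ 0) (har : a < 2 ^ r) :
    ∃ l κ, κ < 2 ^ l ∧ l < r ∧ a = 2 ^ l + κ := by
  refine ⟨Nat.log 2 a, a - 2 ^ Nat.log 2 a, ?_, ?_, ?_⟩
  · have := Nat.lt_pow_succ_log_self (b := 2) (by norm_num) a
    rw [Nat.succ_eq_add_one, pow_succ] at this
    omega
  · exact Nat.log_lt_of_lt_pow ha har
  · have := Nat.pow_log_le_self 2 ha
    omega

lemma sum_cellHaar_mul_nonneg (r : ℕ) (a : Fin (2 ^ r)) (ha : (a : ℕ) ≠ 0)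
    (g : Fin (2 ^ r) → ℝ) (hg : Monotone g) :
    0 ≤ ∑ i : Fin (2 ^ r), cellHaar r a i * g i := by
  have h0 : ∑ i : Fin (2 ^ r), cellHaar r a i = 0 := by
    have := sum_cellHaar_mul_index r a ⟨0, by positivity⟩
    simpa [Fin.ext_iff, ha] using this
  obtain ⟨l, κ, hκ, hl, hak⟩ := exists_level ha a.2
  have hM : 2 ^ (l + 1) * 2 ^ (r - (l + 1)) = 2 ^ r := by rw [← pow_add]; congr 1; omega
  have hMp : 0 < 2 ^ (r - (l + 1)) := by positivity
  have hm : (2 * κ + 1) * 2 ^ (r - (l + 1)) < 2 ^ r := by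
    rw [← hM]; exact Nat.mul_lt_mul_of_pos_right (by rw [pow_succ]; omega) hMp
  let v := g ⟨_, hm⟩
  have : ∑ i : Fin (2 ^ r), cellHaar r a i * g i =
      ∑ i : Fin (2 ^ r), cellHaar r a i * (g i - v) := by
    simp_rw [mul_sub, Finset.sum_sub_distrib, ← Finset.sum_mul, h0]; simp
  rw [this]
  refine Finset.sum_nonneg fun i _ => ?_
  rw [hak, cellHaar_two_pow_add _ _ hκ, mul_assoc]
  refine mul_nonneg (by positivity) ?_
  split_ifs with h1 h2 h2
  · omega
  · have : v ≤ g i := hg (by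
      rw [Fin.le_def]; simp only; rw [← h1]; exact Nat.div_mul_le_self _ _)
    linarith
  · have : g i ≤ v := hg (by
      rw [Fin.le_def]; simp only
      refine le_of_lt ((Nat.div_lt_iff_lt_mul hMp).1 ?_); omega)
    linarith
  · simp

lemma sum_cellHaar_mul_le (r : ℕ) (a : Fin (2 ^ r)) (ha : (a : ℕ) ≠ 0)
    (g : Fin (2 ^ r) → ℝ) (hg : ∀ i, |g i| ≤ 1) :
    ∑ i : Fin (2 ^ r), cellHaar r a i * g i ≤
      2 ^ r * (Real.sqrt (2 ^ Nat.log 2 (a : ℕ)))⁻¹ := by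
  rw [← sum_abs_cellHaar r a ha]
  refine Finset.sum_le_sum fun i _ => (le_abs_self _).trans ?_
  rw [abs_mul]
  exact mul_le_of_le_one_right (abs_nonneg _) (hg i)

lemma sum_inv_two_pow_log (r : ℕ) :
    ∑ a : Fin (2 ^ r), (if (a : ℕ) = 0 then 0 else ((2 : ℝ) ^ Nat.log 2 (a : ℕ))⁻¹) = r := by
  rw [Fin.sum_univ_eq_sum_range (fun a => if a = 0 then 0 else ((2 : ℝ) ^ Nat.log 2 a)⁻¹),
    sum_range_two_pow]
  have : ∀ l ∈ Finset.range r, ∑ κ ∈ Finset.range (2 ^ l),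
      (if 2 ^ l + κ = 0 then 0 else ((2 : ℝ) ^ Nat.log 2 (2 ^ l + κ))⁻¹) = 1 := by
    intro l _
    rw [Finset.sum_congr rfl (g := fun _ => ((2 : ℝ) ^ l)⁻¹)]
    · simp
    · intro κ hκ
      rw [if_neg (by positivity), log_two_pow_add (Finset.mem_range.1 hκ)]
  rw [Finset.sum_congr rfl this]; simp

/-- The values of the tensor-product Haar functions on the dyadic cells of level `r`. -/
def gridHaar {d : ℕ} (r : ℕ) (α c : Fin d → Fin (2 ^ r)) : ℝ :=
  ∏ j, cellHaar r (α j) (c j)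

/-- The Haar coefficients of a function on the dyadic grid of level `r`. -/
def gridCoef {d : ℕ} (r : ℕ) (F : (Fin d → Fin (2 ^ r)) → ℝ) (α : Fin d → Fin (2 ^ r)) : ℝ :=
  (((2 : ℝ) ^ r) ^ d)⁻¹ * ∑ c, gridHaar r α c * F c

lemma sum_prod_mul_prod {d N : ℕ} (M : Fin N → Fin N → ℝ) (K : ℝ)
    (h : ∀ a b, ∑ i, M a i * M b i = if a = b then K else 0) (α β : Fin d → Fin N) :
    ∑ c : Fin d → Fin N, (∏ j, M (α j) (c j)) * (∏ j, M (β j) (c j)) =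
      if α = β then K ^ d else 0 := by
  simp_rw [← Finset.prod_mul_distrib]
  have := Finset.prod_univ_sum (fun _ : Fin d => (Finset.univ : Finset (Fin N)))
    (fun j i => M (α j) i * M (β j) i)
  rw [Fintype.piFinset_univ] at this
  rw [← this]
  simp_rw [h]
  rw [Finset.prod_ite_zero]
  simp [funext_iff]

lemma sum_gridHaar_mul_index {d r : ℕ} (c c' : Fin d → Fin (2 ^ r)) :
    ∑ α, gridHaar r α c * gridHaar r α c' = if c = c' then ((2 : ℝ) ^ r) ^ d else 0 := by
  refine sum_prod_mul_prod (fun i a => cellHaar r a i) _ (fun i i' => ?_) c c'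
  rw [Fin.sum_univ_eq_sum_range (fun a => cellHaar r a i * cellHaar r a i'),
    sum_cellHaar_mul r i.2 i'.2]
  simp [Fin.ext_iff]

lemma sum_gridHaar_mul {d r : ℕ} (α β : Fin d → Fin (2 ^ r)) :
    ∑ c, gridHaar r α c * gridHaar r β c = if α = β then ((2 : ℝ) ^ r) ^ d else 0 :=
  sum_prod_mul_prod (fun a i => cellHaar r a i) _ (sum_cellHaar_mul_index r) α β

lemma sum_gridCoef_mul {d r : ℕ} (F : (Fin d → Fin (2 ^ r)) → ℝ) (c : Fin d → Fin (2 ^ r)) :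
    ∑ α, gridCoef r F α * gridHaar r α c = F c := by
  simp_rw [gridCoef, mul_assoc, ← Finset.mul_sum, Finset.sum_mul]
  rw [Finset.sum_comm]
  have : ∀ c', ∑ α, gridHaar r α c' * F c' * gridHaar r α c =
      if c' = c then ((2 : ℝ) ^ r) ^ d * F c' else 0 := by
    intro c'
    simp_rw [mul_right_comm _ (F c'), ← Finset.sum_mul, sum_gridHaar_mul_index]
    split_ifs <;> simp
  simp_rw [this, Finset.sum_ite_eq', Finset.mem_univ, if_true]
  rw [inv_mul_cancel_left₀ (by positivity)]

lemma sum_sq_synthesis {d r : ℕ} (x : (Fin d → Fin (2 ^ r)) → ℝ) :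
    (((2 : ℝ) ^ r) ^ d)⁻¹ * ∑ c, (∑ α, x α * gridHaar r α c) ^ 2 = ∑ α, x α ^ 2 := by
  rw [inv_mul_eq_iff_eq_mul₀ (by positivity)]
  simp_rw [pow_two (Finset.sum _ _), Finset.sum_mul_sum]
  rw [Finset.sum_comm, Finset.mul_sum]
  refine Finset.sum_congr rfl fun α _ => ?_
  rw [Finset.sum_comm]
  have : ∀ β, ∑ c, x α * gridHaar r α c * (x β * gridHaar r β c) =
      if α = β then ((2 : ℝ) ^ r) ^ d * (x α * x β) else 0 := by
    intro β
    simp_rw [mul_mul_mul_comm (x α), ← Finset.mul_sum, sum_gridHaar_mul]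
    split_ifs <;> ring
  simp_rw [this, Finset.sum_ite_eq, Finset.mem_univ, if_true, pow_two]

lemma sum_gridCoef_sq {d r : ℕ} (F : (Fin d → Fin (2 ^ r)) → ℝ) :
    ∑ α, gridCoef r F α ^ 2 = (((2 : ℝ) ^ r) ^ d)⁻¹ * ∑ c, F c ^ 2 := by
  rw [← sum_sq_synthesis]; simp_rw [sum_gridCoef_mul]

/-- The `L₂` error of an approximation by a partial Haar expansion. -/
lemma sum_sq_partial_sub {d r : ℕ} (F h : (Fin d → Fin (2 ^ r)) → ℝ)
    (p : (Fin d → Fin (2 ^ r)) → Prop) [DecidablePred p] :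
    (((2 : ℝ) ^ r) ^ d)⁻¹ *
        ∑ c, (∑ α ∈ Finset.univ.filter p, h α * gridHaar r α c - F c) ^ 2 =
      ∑ α ∈ Finset.univ.filter p, (h α - gridCoef r F α) ^ 2 +
        ∑ α ∈ Finset.univ.filter (fun α => ¬ p α), gridCoef r F α ^ 2 := by
  have : ∀ c, ∑ α ∈ Finset.univ.filter p, h α * gridHaar r α c - F c =
      ∑ α, ((if p α then h α else 0) - gridCoef r F α) * gridHaar r α c := by
    intro c
    simp_rw [sub_mul, Finset.sum_sub_distrib, sum_gridCoef_mul, Finset.sum_filter, ite_mul,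
      zero_mul]
  simp_rw [this, sum_sq_synthesis]
  rw [← Finset.sum_filter_add_sum_filter_not Finset.univ p]
  congr 1
  · refine Finset.sum_congr rfl fun α hα => ?_
    rw [if_pos (Finset.mem_filter.1 hα).2]
  · refine Finset.sum_congr rfl fun α hα => ?_
    rw [if_neg (Finset.mem_filter.1 hα).2]; ring

lemma sum_sum_update {ι κ : Type*} [Fintype ι] [DecidableEq ι] [Fintype κ]
    (φ : (ι → κ) → ℝ) (j : ι) :
    ∑ c : ι → κ, ∑ i : κ, φ (Function.update c j i) = Fintype.card κ * ∑ c, φ c := by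
  rw [← (Equiv.funSplitAt j κ).symm.sum_comp, ← (Equiv.funSplitAt j κ).symm.sum_comp,
    Fintype.sum_prod_type, Fintype.sum_prod_type]
  have : ∀ (x i : κ) (y : {i // i ≠ j} → κ),
      Function.update ((Equiv.funSplitAt j κ).symm (x, y)) j i =
        (Equiv.funSplitAt j κ).symm (i, y) := by
    intro x i y
    ext k
    by_cases hk : k = j
    · subst hk; simp
    · simp [hk]
  simp_rw [this]
  rw [Finset.sum_const, Finset.card_univ, nsmul_eq_mul, Finset.sum_comm]

lemma gridHaar_update {d r : ℕ} (α c : Fin d → Fin (2 ^ r)) (j : Fin d) (a i : Fin (2 ^ r)) :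
    gridHaar r (Function.update α j a) (Function.update c j i) =
      cellHaar r a i * ∏ k ∈ Finset.univ.erase j, cellHaar r (α k) (c k) := by
  rw [gridHaar, ← Finset.mul_prod_erase _ _ (Finset.mem_univ j)]
  congr 1
  · simp
  · refine Finset.prod_congr rfl fun k hk => ?_
    simp [Finset.ne_of_mem_erase hk]

/-- The one-dimensional Haar coefficient of a grid function along coordinate `j`. -/
def lineCoef {d : ℕ} (r : ℕ) (F : (Fin d → Fin (2 ^ r)) → ℝ) (j : Fin d) (a : Fin (2 ^ r))
    (c : Fin d → Fin (2 ^ r)) : ℝ :=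
  ((2 : ℝ) ^ r)⁻¹ * ∑ i : Fin (2 ^ r), cellHaar r a i * F (Function.update c j i)

lemma gridCoef_lineCoef {d r : ℕ} (F : (Fin d → Fin (2 ^ r)) → ℝ) (j : Fin d)
    (a : Fin (2 ^ r)) (α : Fin d → Fin (2 ^ r)) :
    gridCoef r (lineCoef r F j a) (Function.update α j 0) =
      gridCoef r F (Function.update α j a) := by
  have h : ∀ (c : Fin d → Fin (2 ^ r)) (i : Fin (2 ^ r)),
      gridHaar r (Function.update α j 0) c * cellHaar r a i =
      gridHaar r (Function.update α j a) (Function.update c j i) := by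
    intro c i
    have := gridHaar_update α c j 0 (c j)
    rw [Function.update_eq_self] at this
    rw [this, gridHaar_update]
    simp [mul_comm]
  rw [gridCoef, gridCoef]
  congr 1
  have h2 : ∀ c, gridHaar r (Function.update α j 0) c * lineCoef r F j a c =
      ((2 : ℝ) ^ r)⁻¹ * ∑ i : Fin (2 ^ r), gridHaar r (Function.update α j a)
        (Function.update c j i) * F (Function.update c j i) := by
    intro c
    rw [lineCoef, mul_left_comm, Finset.mul_sum]
    simp_rw [← mul_assoc (gridHaar r _ c), h]
  simp_rw [h2]
  rw [← Finset.mul_sum, inv_mul_eq_iff_eq_mul₀ (by positivity),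
    sum_sum_update (fun c => gridHaar r (Function.update α j a) c * F c)]
  simp

lemma lineCoef_nonneg {d r : ℕ} {F : (Fin d → Fin (2 ^ r)) → ℝ} (hF : Monotone F) (j : Fin d)
    {a : Fin (2 ^ r)} (ha : (a : ℕ) ≠ 0) (c : Fin d → Fin (2 ^ r)) : 0 ≤ lineCoef r F j a c :=
  mul_nonneg (by positivity) (sum_cellHaar_mul_nonneg r a ha (fun i => F (Function.update c j i))
    fun _ _ h => hF (Function.update_mono h))

lemma lineCoef_le {d r : ℕ} {F : (Fin d → Fin (2 ^ r)) → ℝ} (hF : ∀ c, |F c| ≤ 1) (j : Fin d)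
    {a : Fin (2 ^ r)} (ha : (a : ℕ) ≠ 0) (c : Fin d → Fin (2 ^ r)) :
    lineCoef r F j a c ≤ (Real.sqrt (2 ^ Nat.log 2 (a : ℕ)))⁻¹ := by
  rw [lineCoef, inv_mul_le_iff₀ (by positivity)]
  exact sum_cellHaar_mul_le r a ha (fun i => F (Function.update c j i)) fun _ => hF _

lemma sum_gridCoef_sq_of_apply_eq {d r : ℕ} {F : (Fin d → Fin (2 ^ r)) → ℝ} (hF : Monotone F)
    (hF1 : ∀ c, |F c| ≤ 1) (j : Fin d) {a : Fin (2 ^ r)} (ha : (a : ℕ) ≠ 0) :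
    ∑ α ∈ Finset.univ.filter (fun α => α j = a), gridCoef r F α ^ 2 ≤
      (Real.sqrt (2 ^ Nat.log 2 (a : ℕ)))⁻¹ * gridCoef r F (Function.update 0 j a) := by
  set w := (Real.sqrt (2 ^ Nat.log 2 (a : ℕ)))⁻¹
  have e1 : gridCoef r F (Function.update 0 j a) =
      (((2 : ℝ) ^ r) ^ d)⁻¹ * ∑ c, lineCoef r F j a c := by
    rw [← gridCoef_lineCoef, gridCoef]
    simp [gridHaar]
  have e2 : ∑ α ∈ Finset.univ.filter (fun α => α j = a), gridCoef r F α ^ 2 =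
      ∑ α ∈ Finset.univ.filter (fun α => α j = a),
        gridCoef r (lineCoef r F j a) (Function.update α j 0) ^ 2 := by
    refine Finset.sum_congr rfl fun α hα => ?_
    rw [gridCoef_lineCoef, ← (Finset.mem_filter.1 hα).2, Function.update_eq_self]
  have hinj : Set.InjOn (fun α : Fin d → Fin (2 ^ r) => Function.update α j 0)
      (Finset.univ.filter (fun α : Fin d → Fin (2 ^ r) => α j = a)) := by
    intro α hα β hβ h
    simp only [Finset.coe_filter, Finset.mem_univ, true_and, Set.mem_ofPred_eq] at hα hβ
    ext k
    by_cases hk : k = j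
    · rw [hk, hα, hβ]
    · have := congrFun h k
      simp only [Function.update_of_ne hk] at this
      rw [this]
  rw [e2, ← Finset.sum_image (f := fun β => gridCoef r (lineCoef r F j a) β ^ 2) hinj]
  calc _ ≤ ∑ β, gridCoef r (lineCoef r F j a) β ^ 2 :=
        Finset.sum_le_sum_of_subset_of_nonneg (Finset.subset_univ _) fun _ _ _ => sq_nonneg _
    _ = (((2 : ℝ) ^ r) ^ d)⁻¹ * ∑ c, lineCoef r F j a c ^ 2 := sum_gridCoef_sq _
    _ ≤ (((2 : ℝ) ^ r) ^ d)⁻¹ * ∑ c, w * lineCoef r F j a c := by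
        gcongr with c
        rw [pow_two]
        exact mul_le_mul_of_nonneg_right (lineCoef_le hF1 j ha c) (lineCoef_nonneg hF j ha c)
    _ = _ := by rw [e1, ← Finset.mul_sum]; ring

/-- The total influence of a monotone bounded function on the dyadic grid. -/
lemma sum_activeCount_mul_gridCoef_sq_le {d r : ℕ} {F : (Fin d → Fin (2 ^ r)) → ℝ}
    (hF : Monotone F) (hF1 : ∀ c, |F c| ≤ 1) :
    ∑ α : Fin d → Fin (2 ^ r), (activeCount (fun j => (α j : ℕ)) : ℝ) * gridCoef r F α ^ 2 ≤
      Real.sqrt ((d : ℝ) * r) := by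
  let P : Finset (Fin d × Fin (2 ^ r)) := Finset.univ.filter fun p => (p.2 : ℕ) ≠ 0
  let w : Fin d × Fin (2 ^ r) → ℝ := fun p => (Real.sqrt (2 ^ Nat.log 2 (p.2 : ℕ)))⁻¹
  let t : Fin d × Fin (2 ^ r) → ℝ := fun p => gridCoef r F (Function.update 0 p.1 p.2)
  have h1 : ∑ α : Fin d → Fin (2 ^ r),
      (activeCount (fun j => (α j : ℕ)) : ℝ) * gridCoef r F α ^ 2 =
      ∑ p ∈ P, ∑ α ∈ Finset.univ.filter (fun α : Fin d → Fin (2 ^ r) => α p.1 = p.2),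
        gridCoef r F α ^ 2 := by
    simp_rw [P, Finset.sum_filter, Fintype.sum_prod_type, ← Finset.sum_filter,
      activeCount, Finset.card_filter, Nat.cast_sum, Finset.sum_mul]
    rw [Finset.sum_comm]
    refine Finset.sum_congr rfl fun j _ => ?_
    simp_rw [Finset.sum_filter]
    rw [Finset.sum_congr rfl fun (a : Fin (2 ^ r)) _ => show (if (a : ℕ) ≠ 0 then
      ∑ α : Fin d → Fin (2 ^ r), if α j = a then gridCoef r F α ^ 2 else 0 else 0) =
      ∑ α : Fin d → Fin (2 ^ r), if α j = a then
        (if (a : ℕ) ≠ 0 then gridCoef r F α ^ 2 else 0) else 0 by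
        split_ifs <;> simp]
    rw [Finset.sum_comm]
    refine Finset.sum_congr rfl fun α _ => ?_
    rw [Finset.sum_ite_eq]
    simp
  have h2 : ∑ p ∈ P, t p ^ 2 ≤ 1 := by
    have hinj : Set.InjOn (fun p : Fin d × Fin (2 ^ r) =>
        (Function.update 0 p.1 p.2 : Fin d → Fin (2 ^ r))) P := by
      rintro ⟨j, a⟩ ha ⟨k, b⟩ hb h
      simp only [P, Finset.coe_filter, Finset.mem_univ, true_and, Set.mem_ofPred_eq] at ha hb
      have h' := congrFun h j
      simp only [Function.update_self] at h'
      by_cases hjk : j = k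
      · subst hjk; simp at h'; rw [h']
      · rw [Function.update_of_ne hjk] at h'
        exact absurd (by rw [h']; simp) ha
    calc ∑ p ∈ P, t p ^ 2 ≤ ∑ α, gridCoef r F α ^ 2 := by
          simp only [t]
          rw [← Finset.sum_image (f := fun β => gridCoef r F β ^ 2) hinj]
          exact Finset.sum_le_sum_of_subset_of_nonneg (Finset.subset_univ _)
            fun _ _ _ => sq_nonneg _
      _ ≤ 1 := by
          rw [sum_gridCoef_sq, inv_mul_le_iff₀ (by positivity)]
          refine (Finset.sum_le_card_nsmul _ _ 1 fun c _ => ?_).trans (by simp)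
          rw [← sq_abs]; exact pow_le_one₀ (abs_nonneg _) (hF1 c)
  have h3 : ∑ p ∈ P, w p ^ 2 = d * r := by
    simp only [P, w]
    rw [Finset.sum_filter, Fintype.sum_prod_type]
    rw [← sum_inv_two_pow_log r]
    simp only [inv_pow, Real.sq_sqrt (pow_nonneg zero_le_two _), ite_not]
    simp
  rw [h1]
  calc _ ≤ ∑ p ∈ P, w p * t p := Finset.sum_le_sum fun p hp =>
        sum_gridCoef_sq_of_apply_eq hF hF1 p.1 (Finset.mem_filter.1 hp).2
    _ ≤ Real.sqrt (∑ p ∈ P, w p ^ 2) * Real.sqrt (∑ p ∈ P, t p ^ 2) :=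
        Real.sum_mul_le_sqrt_mul_sqrt _ _ _
    _ ≤ Real.sqrt (d * r) * 1 := by
        rw [h3]; gcongr; exact Real.sqrt_le_one.2 h2
    _ = _ := mul_one _

lemma sum_high_gridCoef_sq_le {d r : ℕ} (k : ℕ) {F : (Fin d → Fin (2 ^ r)) → ℝ}
    (hF : Monotone F) (hF1 : ∀ c, |F c| ≤ 1) :
    ∑ α ∈ Finset.univ.filter
        (fun α : Fin d → Fin (2 ^ r) => ¬ activeCount (fun j => (α j : ℕ)) ≤ k),
      gridCoef r F α ^ 2 ≤ Real.sqrt ((d : ℝ) * r) / (k + 1) := by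
  rw [le_div_iff₀ (by positivity)]
  refine le_trans ?_ (sum_activeCount_mul_gridCoef_sq_le hF hF1)
  rw [Finset.sum_mul, Finset.sum_filter]
  refine Finset.sum_le_sum fun α _ => ?_
  split_ifs with h
  · positivity
  · have : (k : ℝ) + 1 ≤ activeCount (fun j => (α j : ℕ)) := by exact_mod_cast not_le.1 h
    rw [mul_comm]
    gcongr

/-- The number of Haar functions with at most `k` active variables and level below `r`. -/
lemma card_activeCount_le {d k : ℕ} (r : ℕ) (hk : 1 ≤ k) (hkd : k ≤ d) :
    ((Finset.univ.filter
      (fun α : Fin d → Fin (2 ^ r) => activeCount (fun j => (α j : ℕ)) ≤ k)).card : ℝ) ≤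
      Real.exp ((k : ℝ) * (1 + Real.log ((d : ℝ) / k) + Real.log 2 * r)) := by
  have hk0 : (0 : ℝ) < k := by exact_mod_cast hk
  have hd0 : (0 : ℝ) < d := hk0.trans_le (by exact_mod_cast hkd)
  have hN : (1 : ℝ) ≤ 2 ^ r := one_le_pow₀ one_le_two
  obtain ⟨x, hx⟩ : ∃ x : ℝ, x = k / (d * 2 ^ r) := ⟨_, rfl⟩
  have hx0 : 0 < x := by rw [hx]; positivity
  have hx1 : x ≤ 1 := by
    rw [hx, div_le_one (by positivity)]
    have : (k : ℝ) ≤ d := by exact_mod_cast hkd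
    nlinarith
  have hpow : ∀ α : Fin d → Fin (2 ^ r), x ^ activeCount (fun j => (α j : ℕ)) =
      ∏ j, if (α j : ℕ) ≠ 0 then x else 1 := by
    intro α
    rw [activeCount, Finset.prod_ite]; simp
  have hsum : ∑ α : Fin d → Fin (2 ^ r), x ^ activeCount (fun j => (α j : ℕ)) ≤
      Real.exp k := by
    simp_rw [hpow]
    have := Finset.prod_univ_sum (fun _ : Fin d => (Finset.univ : Finset (Fin (2 ^ r))))
      (fun _ a => if (a : ℕ) ≠ 0 then x else 1)
    rw [Fintype.piFinset_univ] at this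
    rw [← this, Finset.prod_const, Finset.card_univ, Fintype.card_fin]
    have h1 : ∑ a : Fin (2 ^ r), (if (a : ℕ) ≠ 0 then x else 1) ≤ x * 2 ^ r + 1 := by
      calc _ ≤ ∑ a : Fin (2 ^ r), (x + if (a : ℕ) = 0 then 1 else 0) := by
            refine Finset.sum_le_sum fun a _ => ?_
            by_cases h : (a : ℕ) = 0 <;> simp [h, hx0.le]
        _ = _ := by
            rw [Finset.sum_add_distrib, Fin.sum_univ_eq_sum_range (fun a => if a = 0 then (1 : ℝ) else 0)]
            simp [mul_comm]
    calc _ ≤ (x * 2 ^ r + 1) ^ d := by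
          refine pow_le_pow_left₀ (Finset.sum_nonneg fun a _ => ?_) h1 _
          split_ifs <;> positivity
      _ ≤ Real.exp (x * 2 ^ r) ^ d := by
          gcongr; exact Real.add_one_le_exp _
      _ = Real.exp k := by
          rw [← Real.exp_nat_mul]; congr 1; rw [hx]; field_simp
  have hcard : ((Finset.univ.filter
      (fun α : Fin d → Fin (2 ^ r) => activeCount (fun j => (α j : ℕ)) ≤ k)).card : ℝ) * x ^ k ≤
      Real.exp k := by
    refine le_trans ?_ hsum
    rw [← nsmul_eq_mul, ← Finset.sum_const]
    refine (Finset.sum_le_sum fun α hα => ?_).trans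
      (Finset.sum_le_sum_of_subset_of_nonneg (Finset.subset_univ _) fun _ _ _ => by positivity)
    exact pow_le_pow_of_le_one hx0.le hx1 (Finset.mem_filter.1 hα).2
  rw [← le_div_iff₀ (by positivity)] at hcard
  refine hcard.trans (le_of_eq ?_)
  have hxl : x = Real.exp (-(Real.log ((d : ℝ) / k) + Real.log 2 * r)) := by
    rw [neg_add, Real.exp_add, Real.exp_neg, Real.exp_log (by positivity), Real.exp_neg,
      mul_comm (Real.log 2), Real.exp_nat_mul, Real.exp_log two_pos, hx]
    field_simp
  rw [hxl, ← Real.exp_nat_mul, ← Real.exp_sub]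
  congr 1; ring

lemma mem_dyadicI_iff {r l m i : ℕ} {x : ℝ} (hl : l ≤ r) (hi : i < 2 ^ r)
    (hx : x ∈ Set.Ico ((i : ℝ) / 2 ^ r) (((i : ℝ) + 1) / 2 ^ r)) :
    x ∈ dyadicI l m ↔ i / 2 ^ (r - l) = m := by
  obtain ⟨M, hM⟩ : ∃ M, M = 2 ^ (r - l) := ⟨_, rfl⟩
  have hMp : 0 < M := by rw [hM]; positivity
  have hMl : 2 ^ l * M = 2 ^ r := by rw [hM, ← pow_add]; congr 1; omega
  have hMl' : (2 : ℝ) ^ l * M = 2 ^ r := by exact_mod_cast hMl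
  have hr : (0 : ℝ) < 2 ^ r := by positivity
  have hMr : (0 : ℝ) < M := by exact_mod_cast hMp
  have hdiv : ∀ y : ℝ, y / 2 ^ l = y * M / 2 ^ r := by
    intro y; rw [← hMl']; field_simp
  have hle : ∀ m : ℕ, (m : ℝ) / 2 ^ l ≤ x ↔ m * M ≤ i := by
    intro m
    rw [hdiv]
    constructor
    · intro h
      have := (div_lt_div_iff_of_pos_right hr).1 (h.trans_lt hx.2)
      have : m * M < i + 1 := by exact_mod_cast this
      omega
    · intro h
      refine le_trans ?_ hx.1
      gcongr
      exact_mod_cast h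
  rw [← hM, Nat.div_eq_iff hMp]
  have h2 := hle (m + 1)
  rw [Nat.cast_add_one, ← not_iff_not, not_le, not_le] at h2
  have h3 : i ≤ m * M + M - 1 ↔ i < (m + 1) * M := by rw [add_mul, one_mul]; omega
  rw [h3, ← h2, ← hle, dyadicI]
  split_ifs with h
  · have hx1 : x < 1 := by
      refine hx.2.trans_le ?_
      rw [div_le_one hr]
      exact_mod_cast hi
    have : ((m : ℝ) + 1) / 2 ^ l = 1 := by
      rw [div_eq_one_iff_eq (by positivity)]; exact_mod_cast h
    rw [this]
    exact ⟨fun h => ⟨h.1, hx1⟩, fun h => ⟨h.1, h.2.le⟩⟩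
  · rfl

lemma haar1_eq_cellHaar {r a i : ℕ} {x : ℝ} (ha : a < 2 ^ r) (hi : i < 2 ^ r)
    (hx : x ∈ Set.Ico ((i : ℝ) / 2 ^ r) (((i : ℝ) + 1) / 2 ^ r)) :
    haar1 a x = cellHaar r a i := by
  classical
  by_cases h0 : a = 0
  · subst h0
    have hr : (0 : ℝ) < 2 ^ r := by positivity
    have h1 : 0 ≤ x := le_trans (by positivity) hx.1
    have h2 : x ≤ 1 := by
      refine hx.2.le.trans ?_
      rw [div_le_one hr]
      exact_mod_cast hi
    simp [haar1, h1, h2]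
  · obtain ⟨l, κ, hκ, hl, rfl⟩ := exists_level h0 ha
    rw [cellHaar_two_pow_add _ _ hκ, haar1, if_neg h0, log_two_pow_add hκ,
      Nat.add_sub_cancel_left]
    simp only [Set.indicator_apply, mem_dyadicI_iff (show l + 1 ≤ r from hl) hi hx, Pi.one_apply]

/-- The half-open dyadic cells of level `r`. -/
def dyadicCell {d : ℕ} (r : ℕ) (c : Fin d → Fin (2 ^ r)) : Set (Fin d → ℝ) :=
  Set.pi Set.univ fun j => Set.Ico ((c j : ℝ) / 2 ^ r) (((c j : ℝ) + 1) / 2 ^ r)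

lemma haar_eq_gridHaar {d r : ℕ} (α : Fin d → Fin (2 ^ r)) {c : Fin d → Fin (2 ^ r)}
    {x : Fin d → ℝ} (hx : x ∈ dyadicCell r c) :
    haar (fun j => (α j : ℕ)) x = gridHaar r α c :=
  Finset.prod_congr rfl fun j _ => haar1_eq_cellHaar (α j).2 (c j).2 (hx j trivial)

lemma measurableSet_dyadicCell {d r : ℕ} (c : Fin d → Fin (2 ^ r)) :
    MeasurableSet (dyadicCell r c) :=
  MeasurableSet.univ_pi fun _ => measurableSet_Ico

lemma dyadicCell_subset {d r : ℕ} (c : Fin d → Fin (2 ^ r)) : dyadicCell r c ⊆ unitCube d := by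
  intro x hx
  refine ⟨fun j => le_trans (by positivity) (hx j trivial).1, fun j => ?_⟩
  refine (hx j trivial).2.le.trans ?_
  rw [div_le_iff₀ (by positivity)]
  have := (c j).2
  simp only [Pi.one_apply, one_mul]
  exact_mod_cast this

lemma pairwise_disjoint_dyadicCell {d r : ℕ} :
    Pairwise (Function.onFun Disjoint (dyadicCell r : (Fin d → Fin (2 ^ r)) → _)) := by
  intro c c' h
  rw [Function.onFun, Set.disjoint_left]
  intro x hx hx'
  refine h (funext fun j => Fin.ext ?_)
  have hr : (0 : ℝ) < 2 ^ r := by positivity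
  have h1 := (div_lt_div_iff_of_pos_right hr).1 ((hx j trivial).1.trans_lt (hx' j trivial).2)
  have h2 := (div_lt_div_iff_of_pos_right hr).1 ((hx' j trivial).1.trans_lt (hx j trivial).2)
  norm_cast at h1 h2
  omega

lemma iUnion_dyadicCell (d r : ℕ) :
    ⋃ c, dyadicCell r c = Set.pi Set.univ fun _ : Fin d => Set.Ico (0 : ℝ) 1 := by
  have hr : (0 : ℝ) < 2 ^ r := by positivity
  ext x
  simp only [Set.mem_iUnion]
  constructor
  · rintro ⟨c, hx⟩ j -
    refine ⟨le_trans (by positivity) (hx j trivial).1, (hx j trivial).2.trans_le ?_⟩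
    rw [div_le_iff₀ (by positivity)]
    have := (c j).2
    rw [one_mul]
    exact_mod_cast this
  · intro hx
    have hb : ∀ j, ⌊x j * 2 ^ r⌋₊ < 2 ^ r := by
      intro j
      rw [Nat.floor_lt (mul_nonneg (hx j trivial).1 hr.le)]
      push_cast
      exact mul_lt_of_lt_one_left hr (hx j trivial).2
    refine ⟨fun j => ⟨⌊x j * 2 ^ r⌋₊, hb j⟩, fun j _ => ⟨?_, ?_⟩⟩
    · rw [div_le_iff₀ hr]
      exact Nat.floor_le (mul_nonneg (hx j trivial).1 hr.le)
    · rw [lt_div_iff₀ hr]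
      exact Nat.lt_floor_add_one _

lemma restrict_unitCube_eq (d r : ℕ) :
    (volume.restrict (unitCube d) : Measure (Fin d → ℝ)) =
      volume.restrict (⋃ c : Fin d → Fin (2 ^ r), dyadicCell r c) := by
  rw [iUnion_dyadicCell]
  exact (Measure.restrict_congr_set Measure.univ_pi_Ico_ae_eq_Icc).symm

lemma volume_dyadicCell {d r : ℕ} (c : Fin d → Fin (2 ^ r)) :
    (volume (dyadicCell r c)).toReal = (((2 : ℝ) ^ r) ^ d)⁻¹ := by
  rw [dyadicCell, Real.volume_pi_Ico_toReal]
  · have : ∀ j, ((c j : ℝ) + 1) / 2 ^ r - (c j : ℝ) / 2 ^ r = ((2 : ℝ) ^ r)⁻¹ := by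
      intro j; ring
    simp [this]
  · intro j
    simp only
    gcongr
    linarith

lemma setIntegral_unitCube_eq_sum {d : ℕ} (r : ℕ) {g : (Fin d → ℝ) → ℝ}
    (hg : IntegrableOn g (unitCube d)) :
    ∫ x in unitCube d, g x = ∑ c : Fin d → Fin (2 ^ r), ∫ x in dyadicCell r c, g x := by
  rw [restrict_unitCube_eq d r]
  exact integral_iUnion_fintype measurableSet_dyadicCell pairwise_disjoint_dyadicCell
    fun c => hg.mono_set (dyadicCell_subset c)

/-- Cell averages of a function on the dyadic grid of level `r`. -/
def cellAvg {d : ℕ} (r : ℕ) (g : (Fin d → ℝ) → ℝ) (c : Fin d → Fin (2 ^ r)) : ℝ :=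
  ((2 : ℝ) ^ r) ^ d * ∫ x in dyadicCell r c, g x

lemma setIntegral_dyadicCell {d r : ℕ} (g : (Fin d → ℝ) → ℝ) (c : Fin d → Fin (2 ^ r)) :
    ∫ x in dyadicCell r c, g x = (((2 : ℝ) ^ r) ^ d)⁻¹ * cellAvg r g c := by
  rw [cellAvg, inv_mul_cancel_left₀ (by positivity)]

instance (d : ℕ) : IsProbabilityMeasure (volume.restrict (unitCube d) : Measure (Fin d → ℝ)) :=
  ⟨by simp [unitCube, Real.volume_Icc_pi]⟩

lemma measurableSet_unitCube (d : ℕ) : MeasurableSet (unitCube d) := measurableSet_Icc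

lemma measurable_haar1 (a : ℕ) : Measurable (haar1 a) := by
  have hI : ∀ l m, MeasurableSet (dyadicI l m) := by
    intro l m
    rw [dyadicI]
    split_ifs
    · exact measurableSet_Icc
    · exact measurableSet_Ico
  unfold haar1
  split_ifs
  · exact measurable_one.indicator measurableSet_Icc
  · exact ((measurable_one.indicator (hI _ _)).sub
      (measurable_one.indicator (hI _ _))).const_mul _

lemma measurable_haar {d : ℕ} (α : Fin d → ℕ) : Measurable (haar α) :=
  Finset.measurable_prod _ fun j _ => (measurable_haar1 (α j)).comp (measurable_pi_apply j)

lemma abs_haar1_le (a : ℕ) (x : ℝ) : |haar1 a x| ≤ Real.sqrt (2 ^ Nat.log 2 a) := by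
  classical
  unfold haar1
  split_ifs with h
  · subst h
    by_cases hx : x ∈ Set.Icc (0 : ℝ) 1 <;> simp [hx]
  · rw [abs_mul, abs_of_nonneg (Real.sqrt_nonneg _)]
    refine mul_le_of_le_one_right (Real.sqrt_nonneg _) ?_
    simp only [Set.indicator_apply, Pi.one_apply]
    split_ifs <;> norm_num

lemma abs_haar_le {d : ℕ} (α : Fin d → ℕ) (x : Fin d → ℝ) :
    |haar α x| ≤ ∏ j, Real.sqrt (2 ^ Nat.log 2 (α j)) := by
  rw [haar, Finset.abs_prod]
  exact Finset.prod_le_prod (fun _ _ => abs_nonneg _) fun j _ => abs_haar1_le _ _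

lemma memLp_haar_mul {d : ℕ} (α : Fin d → ℕ) {g : (Fin d → ℝ) → ℝ} (hg : Measurable g)
    (hg1 : ∀ x, |g x| ≤ 1) (p : ℝ≥0∞) :
    MemLp (fun x => haar α x * g x) p (volume.restrict (unitCube d)) := by
  refine MemLp.of_bound ((measurable_haar α).mul hg).aestronglyMeasurable
    (∏ j, Real.sqrt (2 ^ Nat.log 2 (α j))) (Filter.Eventually.of_forall fun x => ?_)
  rw [Real.norm_eq_abs, abs_mul]
  exact (mul_le_of_le_one_right (abs_nonneg _) (hg1 x)).trans (abs_haar_le α x)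

lemma integral_haar_mul {d r : ℕ} (α : Fin d → Fin (2 ^ r)) {g : (Fin d → ℝ) → ℝ}
    (hg : Measurable g) (hg1 : ∀ x, |g x| ≤ 1) :
    ∫ x in unitCube d, haar (fun j => (α j : ℕ)) x * g x = gridCoef r (cellAvg r g) α := by
  rw [setIntegral_unitCube_eq_sum r
    ((memLp_haar_mul (fun j => (α j : ℕ)) hg hg1 1).integrable le_rfl), gridCoef, Finset.mul_sum]
  refine Finset.sum_congr rfl fun c _ => ?_
  rw [setIntegral_congr_fun (measurableSet_dyadicCell c)
    (g := fun x => gridHaar r α c * g x) fun x hx => by simp only; rw [haar_eq_gridHaar α hx],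
    integral_const_mul, setIntegral_dyadicCell]
  ring

lemma integral_haar_sq {d r : ℕ} (α : Fin d → Fin (2 ^ r)) :
    ∫ x in unitCube d, haar (fun j => (α j : ℕ)) x ^ 2 = 1 := by
  have hint : IntegrableOn (fun x => haar (fun j => (α j : ℕ)) x ^ 2) (unitCube d) := by
    have := (memLp_haar_mul (fun j => (α j : ℕ)) (g := fun _ => 1) measurable_const
      (by simp) 2).integrable_sq
    simpa [IntegrableOn] using this
  rw [setIntegral_unitCube_eq_sum r hint]
  have : ∀ c, ∫ x in dyadicCell r c, haar (fun j => (α j : ℕ)) x ^ 2 =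
      (((2 : ℝ) ^ r) ^ d)⁻¹ * (gridHaar r α c * gridHaar r α c) := by
    intro c
    rw [setIntegral_congr_fun (measurableSet_dyadicCell c)
      (g := fun x => gridHaar r α c ^ 2) fun x hx => by simp only; rw [haar_eq_gridHaar α hx]]
    simp only [integral_const, measureReal_restrict_apply_univ, smul_eq_mul]
    rw [Measure.real, volume_dyadicCell, pow_two]
  simp_rw [this, ← Finset.mul_sum, sum_gridHaar_mul, if_true]
  rw [inv_mul_cancel₀ (by positivity)]

lemma cellAvg_congr {d : ℕ} (r : ℕ) {g g₀ : (Fin d → ℝ) → ℝ}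
    (h : g =ᵐ[volume.restrict (unitCube d)] g₀) : cellAvg r g = cellAvg r g₀ := by
  funext c
  rw [cellAvg, cellAvg]
  congr 1
  exact integral_congr_ae (ae_restrict_of_ae_restrict_of_subset (dyadicCell_subset c) h)

lemma abs_cellAvg_le {d r : ℕ} {g : (Fin d → ℝ) → ℝ} (hg1 : ∀ x ∈ unitCube d, |g x| ≤ 1)
    (c : Fin d → Fin (2 ^ r)) : |cellAvg r g c| ≤ 1 := by
  have hfin : volume (dyadicCell r c) < ⊤ := by
    refine (measure_mono (dyadicCell_subset c)).trans_lt ?_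
    simp [unitCube, Real.volume_Icc_pi]
  have := norm_setIntegral_le_of_norm_le_const (f := g) (C := 1) hfin
    (fun x hx => hg1 x (dyadicCell_subset c hx))
  rw [Measure.real, volume_dyadicCell, one_mul, Real.norm_eq_abs] at this
  rw [cellAvg, abs_mul, abs_of_pos (by positivity : (0 : ℝ) < ((2 : ℝ) ^ r) ^ d)]
  calc _ ≤ ((2 : ℝ) ^ r) ^ d * (((2 : ℝ) ^ r) ^ d)⁻¹ := by gcongr
    _ = 1 := mul_inv_cancel₀ (by positivity)

lemma monotone_cellAvg {d r : ℕ} {g : (Fin d → ℝ) → ℝ} (hg : g ∈ FMon d)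
    (hint : IntegrableOn g (unitCube d)) : Monotone (cellAvg r g) := by
  intro c c' hc
  let h : Fin d → ℝ := fun j => ((c' j : ℝ) - c j) / 2 ^ r
  have hr : (0 : ℝ) < 2 ^ r := by positivity
  have h0 : 0 ≤ h := by
    intro j
    refine div_nonneg (sub_nonneg.2 ?_) hr.le
    exact Nat.cast_le.2 (Fin.le_def.1 (hc j))
  have hpre : (fun x => x + h) ⁻¹' dyadicCell r c' = dyadicCell r c := by
    ext x
    simp only [dyadicCell, Set.mem_preimage, Set.mem_pi, Set.mem_univ, true_implies,
      Set.mem_Ico, Pi.add_apply, h]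
    refine forall_congr' fun j => ?_
    have e1 : (c' j : ℝ) / 2 ^ r = (c j : ℝ) / 2 ^ r + ((c' j : ℝ) - c j) / 2 ^ r := by ring
    have e2 : ((c' j : ℝ) + 1) / 2 ^ r =
        ((c j : ℝ) + 1) / 2 ^ r + ((c' j : ℝ) - c j) / 2 ^ r := by ring
    rw [e1, e2, add_le_add_iff_right, add_lt_add_iff_right]
  have hmp : MeasurePreserving (fun x : Fin d → ℝ => x + h) volume volume :=
    measurePreserving_add_right volume h
  have hemb : MeasurableEmbedding (fun x : Fin d → ℝ => x + h) :=
    measurableEmbedding_addRight h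
  have hshift := hmp.setIntegral_preimage_emb hemb g (dyadicCell r c')
  rw [hpre] at hshift
  have hi : IntegrableOn (fun x => g (x + h)) (dyadicCell r c) := by
    rw [← hpre]
    exact (hmp.integrableOn_comp_preimage hemb).2 (hint.mono_set (dyadicCell_subset c'))
  rw [cellAvg, cellAvg, ← hshift]
  refine mul_le_mul_of_nonneg_left ?_ (by positivity)
  refine setIntegral_mono_on (hint.mono_set (dyadicCell_subset c)) hi
    (measurableSet_dyadicCell c) fun x hx => ?_
  refine hg.2 x (dyadicCell_subset c hx) (x + h) (dyadicCell_subset c' ?_)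
    (le_add_of_nonneg_right h0)
  rw [← hpre] at hx
  exact hx

/-- Summing a bounded function's increments along the diagonal of a grid. -/
lemma sum_diagonal_increment_le {d N : ℕ} (hN : 1 ≤ N) {u : (Fin d → ℕ) → ℝ}
    (hu : ∀ m, (∀ j, m j ≤ N) → |u m| ≤ 1) :
    ∑ c : Fin d → Fin N, (u (fun j => c j + 1) - u (fun j => c j)) ≤
      2 * ((N : ℝ) ^ d - ((N : ℝ) - 1) ^ d) := by
  let A : Finset (Fin d → ℕ) := Fintype.piFinset fun _ => Finset.Ico 1 (N + 1)
  let B : Finset (Fin d → ℕ) := Fintype.piFinset fun _ => Finset.Ico 0 N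
  let C : Finset (Fin d → ℕ) := Fintype.piFinset fun _ => Finset.Ico 1 N
  have hCA : C ⊆ A := Fintype.piFinset_subset _ _ fun _ =>
    Finset.Ico_subset_Ico le_rfl (Nat.le_succ N)
  have hCB : C ⊆ B := Fintype.piFinset_subset _ _ fun _ =>
    Finset.Ico_subset_Ico zero_le_one le_rfl
  have hA : ∑ c : Fin d → Fin N, u (fun j => c j + 1) = ∑ m ∈ A, u m := by
    refine Finset.sum_nbij (fun c j => (c j : ℕ) + 1) ?_ ?_ ?_ fun _ _ => rfl
    · intro c _
      simp only [A, Fintype.mem_piFinset, Finset.mem_Ico]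
      intro j; have := (c j).2; omega
    · intro c _ c' _ h
      funext j
      have := congrFun h j
      simp only at this
      exact Fin.ext (by omega)
    · intro m hm
      simp only [A, Finset.mem_coe, Fintype.mem_piFinset, Finset.mem_Ico] at hm
      refine ⟨fun j => ⟨m j - 1, by have := hm j; omega⟩, Finset.mem_coe.2 (Finset.mem_univ _),
        funext fun j => ?_⟩
      have := hm j
      simp only
      omega
  have hB : ∑ c : Fin d → Fin N, u (fun j => c j) = ∑ m ∈ B, u m := by
    refine Finset.sum_nbij (fun c j => (c j : ℕ)) ?_ ?_ ?_ fun _ _ => rfl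
    · intro c _
      simp only [B, Fintype.mem_piFinset, Finset.mem_Ico]
      intro j; have := (c j).2; omega
    · intro c _ c' _ h
      funext j
      exact Fin.ext (congrFun h j)
    · intro m hm
      simp only [B, Finset.mem_coe, Fintype.mem_piFinset, Finset.mem_Ico] at hm
      exact ⟨fun j => ⟨m j, (hm j).2⟩, Finset.mem_coe.2 (Finset.mem_univ _), rfl⟩
  have hcC : (C.card : ℝ) = ((N : ℝ) - 1) ^ d := by
    simp only [C, Fintype.card_piFinset, Nat.card_Ico, Finset.prod_const, Finset.card_univ,
      Fintype.card_fin]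
    push_cast [hN]; rfl
  have hdA : ((A \ C).card : ℝ) = (N : ℝ) ^ d - ((N : ℝ) - 1) ^ d := by
    rw [Finset.cast_card_sdiff hCA, hcC]
    simp [A, Fintype.card_piFinset]
  have hdB : ((B \ C).card : ℝ) = (N : ℝ) ^ d - ((N : ℝ) - 1) ^ d := by
    rw [Finset.cast_card_sdiff hCB, hcC]
    simp [B, Fintype.card_piFinset]
  have h1 : ∑ m ∈ A \ C, u m ≤ (A \ C).card := by
    refine (Finset.sum_le_card_nsmul _ _ 1 fun m hm => ?_).trans (by simp)
    refine (abs_le.1 (hu m fun j => ?_)).2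
    have := Fintype.mem_piFinset.1 (Finset.mem_sdiff.1 hm).1 j
    rw [Finset.mem_Ico] at this; omega
  have h2 : -((B \ C).card : ℝ) ≤ ∑ m ∈ B \ C, u m := by
    refine le_trans (by simp) (Finset.card_nsmul_le_sum (B \ C) u (-1) fun m hm => ?_)
    refine (abs_le.1 (hu m fun j => ?_)).1
    have := Fintype.mem_piFinset.1 (Finset.mem_sdiff.1 hm).1 j
    rw [Finset.mem_Ico] at this; omega
  rw [Finset.sum_sub_distrib, hA, hB, ← Finset.sum_sdiff hCA, ← Finset.sum_sdiff hCB]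
  linarith

/-- The mean within-cell variance of a sign-valued monotone function. -/
lemma sum_one_sub_cellAvg_sq_le {d : ℕ} (r : ℕ) {g : (Fin d → ℝ) → ℝ} (hg : g ∈ FMonPM d) :
    (((2 : ℝ) ^ r) ^ d)⁻¹ * ∑ c : Fin d → Fin (2 ^ r), (1 - cellAvg r g c ^ 2) ≤
      (d : ℝ) / 2 ^ r := by
  have hr : (0 : ℝ) < 2 ^ r := by positivity
  have hr1 : (1 : ℝ) ≤ 2 ^ r := one_le_pow₀ one_le_two
  obtain ⟨hgm, hpm⟩ := hg
  let u : (Fin d → ℕ) → ℝ := fun m => g fun j => (m j : ℝ) / 2 ^ r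
  have hmem : ∀ m : Fin d → ℕ, (∀ j, m j ≤ 2 ^ r) →
      (fun j => (m j : ℝ) / 2 ^ r) ∈ unitCube d := by
    intro m hm
    refine ⟨fun j => ?_, fun j => ?_⟩
    · simp only [Pi.zero_apply]; positivity
    · simp only [Pi.one_apply]
      rw [div_le_one hr]
      exact_mod_cast hm j
  have hcell : ∀ c : Fin d → Fin (2 ^ r), 1 - cellAvg r g c ^ 2 ≤
      (1 / 2) * (u (fun j => c j + 1) - u (fun j => c j)) := by
    intro c
    have hlo := hmem (fun j => c j) fun j => (c j).2.le
    have hhi := hmem (fun j => c j + 1) fun j => (c j).2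
    have hsq := sq_nonneg (cellAvg r g c)
    have hle : u (fun j => c j) ≤ u (fun j => c j + 1) := by
      refine hgm.2 _ hlo _ hhi fun j => ?_
      simp only
      gcongr
      linarith
    by_cases he : u (fun j => c j) = u (fun j => c j + 1)
    · have hconst : Set.EqOn g (fun _ => u fun j => c j) (dyadicCell r c) := by
        intro x hx
        have hxc := dyadicCell_subset c hx
        refine le_antisymm ?_ (hgm.2 _ hlo _ hxc fun j => (hx j trivial).1)
        simp only
        rw [he]
        refine hgm.2 _ hxc _ hhi fun j => ?_
        have := (hx j trivial).2.le
        simpa using this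
      have : cellAvg r g c = u fun j => c j := by
        rw [cellAvg, setIntegral_congr_fun (measurableSet_dyadicCell c) hconst]
        simp only [integral_const, measureReal_restrict_apply_univ, smul_eq_mul]
        rw [Measure.real, volume_dyadicCell, mul_inv_cancel_left₀ (by positivity)]
      rw [this, ← he]
      rcases hpm _ hlo with h | h <;> (simp only [u]; rw [h]; norm_num)
    · have h1 : u (fun j => c j) = -1 ∨ u (fun j => c j) = 1 := hpm _ hlo
      have h2 : u (fun j => c j + 1) = -1 ∨ u (fun j => c j + 1) = 1 := hpm _ hhi
      rcases h1 with h1 | h1 <;> rcases h2 with h2 | h2 <;> rw [h1, h2] at hle he ⊢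
      · exact absurd rfl he
      · linarith
      · norm_num at hle
      · exact absurd rfl he
  have hsum := sum_diagonal_increment_le (d := d) (N := 2 ^ r) Nat.one_le_two_pow (u := u)
    fun m hm => abs_le.2 (hgm.1 _ (hmem m hm))
  have hbern := one_add_mul_le_pow (a := -((2 : ℝ) ^ r)⁻¹)
    (by have := inv_le_one_of_one_le₀ hr1; linarith) d
  rw [inv_mul_le_iff₀ (by positivity)]
  calc _ ≤ ∑ c : Fin d → Fin (2 ^ r),
        (1 / 2) * (u (fun j => c j + 1) - u (fun j => c j)) :=
        Finset.sum_le_sum fun c _ => hcell c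
    _ ≤ ((2 : ℝ) ^ r) ^ d - ((2 : ℝ) ^ r - 1) ^ d := by
        rw [← Finset.mul_sum]
        push_cast at hsum
        linarith
    _ = ((2 : ℝ) ^ r) ^ d * (1 - (1 + -((2 : ℝ) ^ r)⁻¹) ^ d) := by
        rw [mul_sub, mul_one, ← mul_pow, mul_add, mul_one, mul_neg,
          mul_inv_cancel₀ hr.ne', sub_eq_add_neg ((2 : ℝ) ^ r) 1]
    _ ≤ ((2 : ℝ) ^ r) ^ d * ((d : ℝ) / 2 ^ r) := by
        gcongr
        rw [div_eq_mul_inv]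
        linarith

lemma sgn_eq_neg_one_or_one (t : ℝ) : sgn t = -1 ∨ sgn t = 1 := by
  unfold sgn; split_ifs <;> simp

lemma measurable_sgn : Measurable sgn :=
  Measurable.ite measurableSet_Ici measurable_const measurable_const

lemma monotone_sgn : Monotone sgn := by
  intro a b h
  unfold sgn
  split_ifs <;> linarith

lemma abs_sgn (t : ℝ) : |sgn t| = 1 := by
  rcases sgn_eq_neg_one_or_one t with h | h <;> simp [h]

lemma abs_sub_eq_one_sub_mul {a b : ℝ} (ha : a = -1 ∨ a = 1) (hb : b = -1 ∨ b = 1) :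
    |a - b| = 1 - a * b := by
  rcases ha with rfl | rfl <;> rcases hb with rfl | rfl <;> norm_num

lemma one_sub_sgn_mul_le {G F : ℝ} (hF : |F| ≤ 1) :
    1 - sgn G * F ≤ 2 * (G - F) ^ 2 + 2 * (1 - F ^ 2) := by
  obtain ⟨h1, h2⟩ := abs_le.1 hF
  unfold sgn
  split_ifs with hG
  · rcases le_total 0 F with h | h
    · nlinarith [sq_nonneg (G - F), mul_nonneg h (sub_nonneg.2 h2)]
    · nlinarith [mul_nonneg hG (neg_nonneg.2 h), sq_nonneg G]
  · push Not at hG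
    rcases le_total 0 F with h | h
    · nlinarith [mul_nonneg (neg_nonneg.2 hG.le) h, sq_nonneg G]
    · nlinarith [sq_nonneg (G - F), mul_nonneg (neg_nonneg.2 h) (neg_le_iff_add_nonneg.1 h1)]

/-- The error of the sign of a Haar polynomial against a sign-valued function, in terms of the
quadratic error on the grid and the within-cell variances. -/
lemma dist1e_sgn_haar_sum_le {d r : ℕ} (S : Finset (Fin d → Fin (2 ^ r)))
    (h : (Fin d → Fin (2 ^ r)) → ℝ) {g : (Fin d → ℝ) → ℝ} (hg : Measurable g)
    (hpm : ∀ x, g x = -1 ∨ g x = 1) :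
    dist1e (fun x => sgn (∑ α ∈ S, h α * haar (fun j => (α j : ℕ)) x)) g ≤
      ENNReal.ofReal (2 * ((((2 : ℝ) ^ r) ^ d)⁻¹ * ∑ c : Fin d → Fin (2 ^ r),
          (∑ α ∈ S, h α * gridHaar r α c - cellAvg r g c) ^ 2) +
        2 * ((((2 : ℝ) ^ r) ^ d)⁻¹ * ∑ c : Fin d → Fin (2 ^ r), (1 - cellAvg r g c ^ 2))) := by
  have hg1 : ∀ x, |g x| ≤ 1 := fun x => by rcases hpm x with h | h <;> simp [h]
  have hm : Measurable fun x => sgn (∑ α ∈ S, h α * haar (fun j => (α j : ℕ)) x) :=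
    measurable_sgn.comp (Finset.measurable_sum _ fun α _ => (measurable_haar _).const_mul _)
  have hint : Integrable
      (fun x => |sgn (∑ α ∈ S, h α * haar (fun j => (α j : ℕ)) x) - g x|)
      (volume.restrict (unitCube d)) := by
    refine Integrable.of_bound (hm.sub hg).abs.aestronglyMeasurable 2
      (Filter.Eventually.of_forall fun x => ?_)
    rw [Real.norm_eq_abs, abs_abs]
    refine (abs_sub _ _).trans ?_
    rw [abs_sgn]
    linarith [hg1 x]
  have hcell : ∀ c : Fin d → Fin (2 ^ r),
      ∫ x in dyadicCell r c, |sgn (∑ α ∈ S, h α * haar (fun j => (α j : ℕ)) x) - g x| =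
        (((2 : ℝ) ^ r) ^ d)⁻¹ * (1 - sgn (∑ α ∈ S, h α * gridHaar r α c) * cellAvg r g c) := by
    intro c
    have hgi : IntegrableOn g (dyadicCell r c) := by
      have : IntegrableOn g (unitCube d) :=
        Integrable.of_bound hg.aestronglyMeasurable 1 (Filter.Eventually.of_forall hg1)
      exact this.mono_set (dyadicCell_subset c)
    have h1 : IntegrableOn (fun _ : Fin d → ℝ => (1 : ℝ)) (dyadicCell r c) := by
      have : IntegrableOn (fun _ : Fin d → ℝ => (1 : ℝ)) (unitCube d) := integrable_const _
      exact this.mono_set (dyadicCell_subset c)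
    rw [setIntegral_congr_fun (measurableSet_dyadicCell c)
      (g := fun x => 1 - sgn (∑ α ∈ S, h α * gridHaar r α c) * g x) fun x hx => by
        simp only
        rw [abs_sub_eq_one_sub_mul (sgn_eq_neg_one_or_one _) (hpm x),
          Finset.sum_congr rfl fun α _ => by rw [haar_eq_gridHaar α hx]],
      integral_sub h1 (hgi.const_mul _), integral_const_mul, setIntegral_dyadicCell g,
      setIntegral_const, Measure.real, volume_dyadicCell, smul_eq_mul]
    ring
  rw [dist1e, ← ofReal_integral_eq_lintegral_ofReal hint
    (Filter.Eventually.of_forall fun _ => abs_nonneg _), setIntegral_unitCube_eq_sum r hint]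
  refine ENNReal.ofReal_le_ofReal ?_
  simp_rw [hcell]
  rw [← Finset.mul_sum, mul_left_comm 2, mul_left_comm 2, ← mul_add, Finset.mul_sum _ _ (2 : ℝ),
    Finset.mul_sum _ _ (2 : ℝ), ← Finset.sum_add_distrib]
  refine mul_le_mul_of_nonneg_left (Finset.sum_le_sum fun c _ => ?_) (by positivity)
  exact one_sub_sgn_mul_le (abs_cellAvg_le (fun x _ => hg1 x) c)

/-- The empirical mean of a square-integrable function has variance at most `E Y² / n`. -/
lemma integral_sq_empirical_sub_le {Ω : Type*} [MeasurableSpace Ω] {μ : Measure Ω}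
    [IsProbabilityMeasure μ] {n : ℕ} (hn : 1 ≤ n) {Y : Ω → ℝ} (hY : MemLp Y 2 μ) :
    Integrable (fun ξ : Fin n → Ω => ((n : ℝ)⁻¹ * ∑ i, Y (ξ i) - ∫ x, Y x ∂μ) ^ 2)
        (Measure.pi fun _ => μ) ∧
      ∫ ξ : Fin n → Ω, ((n : ℝ)⁻¹ * ∑ i, Y (ξ i) - ∫ x, Y x ∂μ) ^ 2 ∂(Measure.pi fun _ => μ) ≤
        (∫ x, Y x ^ 2 ∂μ) / n := by
  have hn0 : (0 : ℝ) < n := by exact_mod_cast hn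
  have hYi : ∀ i : Fin n, MemLp (fun ξ : Fin n → Ω => Y (ξ i)) 2 (Measure.pi fun _ => μ) :=
    fun i => hY.comp_measurePreserving (measurePreserving_eval (fun _ => μ) i)
  have hZ : MemLp (fun ξ : Fin n → Ω => (n : ℝ)⁻¹ * ∑ i, Y (ξ i)) 2 (Measure.pi fun _ => μ) :=
    (memLp_finsetSum _ fun i _ => hYi i).const_mul _
  have hmean : ∫ ξ : Fin n → Ω, (n : ℝ)⁻¹ * ∑ i, Y (ξ i) ∂(Measure.pi fun _ => μ) =
      ∫ x, Y x ∂μ := by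
    rw [integral_const_mul, integral_finsetSum _ fun i _ => (hYi i).integrable one_le_two]
    have : ∀ i : Fin n, ∫ ξ : Fin n → Ω, Y (ξ i) ∂(Measure.pi fun _ => μ) = ∫ x, Y x ∂μ :=
      fun i => integral_comp_eval (μ := fun _ => μ) hY.aestronglyMeasurable
    simp_rw [this]
    simp [hn0.ne']
  refine ⟨(hZ.sub (memLp_const _)).integrable_sq, ?_⟩
  have hvar := ProbabilityTheory.variance_eq_integral hZ.aestronglyMeasurable.aemeasurable
  rw [hmean] at hvar
  have hsum := ProbabilityTheory.variance_sum_pi (μ := fun _ : Fin n => μ)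
    (X := fun _ => Y) fun _ => hY
  have heq : (∑ i : Fin n, fun ξ : Fin n → Ω => Y (ξ i)) = fun ξ => ∑ i, Y (ξ i) := by
    funext ξ; simp
  rw [heq] at hsum
  rw [← hvar, ProbabilityTheory.variance_const_mul, hsum]
  have hle := ProbabilityTheory.variance_le_expectation_sq (μ := μ) hY.aestronglyMeasurable
  simp only [Pi.pow_apply] at hle
  simp only [Finset.sum_const, Finset.card_univ, Fintype.card_fin, nsmul_eq_mul]
  calc _ = ProbabilityTheory.variance Y μ / n := by field_simp
    _ ≤ _ := by gcongr

/-- The expected error of the sign-valued method for (a measurable version of) a sign-valued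
monotone function. -/
lemma lintegral_dist1e_hatAlg_le {d n k r : ℕ} (hn : 1 ≤ n) (hk : 1 ≤ k) (hkd : k ≤ d)
    {g g₀ : (Fin d → ℝ) → ℝ} (hg : Measurable g) (hpm : ∀ x, g x = -1 ∨ g x = 1)
    (hg₀ : g₀ ∈ FMonPM d) (hgg : g =ᵐ[volume.restrict (unitCube d)] g₀) :
    ∫⁻ ξ, dist1e (hatAlg d n k r ξ g) g ∂sampleMeasure d n ≤
      ENNReal.ofReal (2 * ((d : ℝ) / 2 ^ r) + 2 * (Real.sqrt ((d : ℝ) * r) / ((k : ℝ) + 1)) +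
        2 * (Real.exp ((k : ℝ) * (1 + Real.log ((d : ℝ) / k) + Real.log 2 * r)) / n)) := by
  have hg1 : ∀ x, |g x| ≤ 1 := fun x => by rcases hpm x with h | h <;> simp [h]
  have hgi : IntegrableOn g (unitCube d) :=
    Integrable.of_bound hg.aestronglyMeasurable 1 (Filter.Eventually.of_forall hg1)
  have hmono : Monotone (cellAvg r g) := by
    rw [cellAvg_congr r hgg]
    exact monotone_cellAvg hg₀.1 (Integrable.congr hgi hgg)
  have hhigh := sum_high_gridCoef_sq_le k hmono fun c => abs_cellAvg_le (fun x _ => hg1 x) c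
  have hvar := sum_one_sub_cellAvg_sq_le r hg₀
  rw [← cellAvg_congr r hgg] at hvar
  let S : Finset (Fin d → Fin (2 ^ r)) :=
    Finset.univ.filter fun α => activeCount (fun j => (α j : ℕ)) ≤ k
  let D : (Fin d → Fin (2 ^ r)) → (Fin n → (Fin d → ℝ)) → ℝ := fun α ξ =>
    ((n : ℝ)⁻¹ * ∑ i, haar (fun j => (α j : ℕ)) (ξ i) * g (ξ i) -
      gridCoef r (cellAvg r g) α) ^ 2
  have hD : ∀ α, Integrable (D α) (sampleMeasure d n) ∧ ∫ ξ, D α ξ ∂sampleMeasure d n ≤ 1 / n := by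
    intro α
    have := integral_sq_empirical_sub_le hn (memLp_haar_mul (fun j => (α j : ℕ)) hg hg1 2)
    have hsq : ∀ x, (haar (fun j => (α j : ℕ)) x * g x) ^ 2 = haar (fun j => (α j : ℕ)) x ^ 2 := by
      intro x
      rcases hpm x with h | h <;> simp [h]
    simp_rw [hsq] at this
    rw [integral_haar_mul α hg hg1, integral_haar_sq] at this
    exact this
  have hcard := card_activeCount_le (d := d) r hk hkd
  have hpt : ∀ ξ, dist1e (hatAlg d n k r ξ g) g ≤ ENNReal.ofReal (2 * ∑ α ∈ S, D α ξ +
      (2 * ((d : ℝ) / 2 ^ r) + 2 * (Real.sqrt ((d : ℝ) * r) / ((k : ℝ) + 1)))) := by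
    intro ξ
    refine (dist1e_sgn_haar_sum_le S (fun α => (n : ℝ)⁻¹ *
      ∑ i, haar (fun j => (α j : ℕ)) (ξ i) * g (ξ i)) hg hpm).trans
      (ENNReal.ofReal_le_ofReal ?_)
    rw [sum_sq_partial_sub]
    simp only [D]
    linarith
  have hint : Integrable (fun ξ => 2 * ∑ α ∈ S, D α ξ +
      (2 * ((d : ℝ) / 2 ^ r) + 2 * (Real.sqrt ((d : ℝ) * r) / ((k : ℝ) + 1))))
      (sampleMeasure d n) := by
    have : IsProbabilityMeasure (sampleMeasure d n) := by unfold sampleMeasure; infer_instance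
    exact ((integrable_finsetSum _ fun α _ => (hD α).1).const_mul _).add (integrable_const _)
  refine (lintegral_mono hpt).trans ?_
  rw [← ofReal_integral_eq_lintegral_ofReal hint (Filter.Eventually.of_forall fun ξ => by
    have : 0 ≤ ∑ α ∈ S, D α ξ := Finset.sum_nonneg fun α _ => sq_nonneg _
    positivity)]
  refine ENNReal.ofReal_le_ofReal ?_
  have : IsProbabilityMeasure (sampleMeasure d n) := by unfold sampleMeasure; infer_instance
  rw [integral_add ((integrable_finsetSum _ fun α _ => (hD α).1).const_mul _)
    (integrable_const _), integral_const_mul, integral_finsetSum _ fun α _ => (hD α).1]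
  have hS : ∑ α ∈ S, ∫ ξ, D α ξ ∂sampleMeasure d n ≤
      Real.exp ((k : ℝ) * (1 + Real.log ((d : ℝ) / k) + Real.log 2 * r)) / n := by
    refine (Finset.sum_le_card_nsmul _ _ _ fun α _ => (hD α).2).trans ?_
    rw [nsmul_eq_mul, mul_one_div]
    gcongr
  simp only [integral_const, probReal_univ, smul_eq_mul, one_mul]
  linarith

lemma exists_measurable_ae_eq_of_mem_FMon {d : ℕ} {f : (Fin d → ℝ) → ℝ} (hf : f ∈ FMon d) :
    ∃ f' : (Fin d → ℝ) → ℝ, Measurable f' ∧ (∀ x, f' x ∈ Set.Icc (-1 : ℝ) 1) ∧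
      f' =ᵐ[volume.restrict (unitCube d)] f := by
  let clamp : (Fin d → ℝ) → Fin d → ℝ := fun x j => max 0 (min 1 (x j))
  have hclamp : ∀ x, clamp x ∈ unitCube d := fun x =>
    ⟨fun j => le_max_left _ _, fun j => max_le zero_le_one (min_le_left _ _)⟩
  have hclamp_eq : ∀ x ∈ unitCube d, clamp x = x := by
    intro x hx
    funext j
    have h0 : 0 ≤ x j := hx.1 j
    have h1 : x j ≤ 1 := hx.2 j
    simp [clamp, h0, h1]
  have hmono : Monotone fun x => f (clamp x) := fun x y hxy =>
    hf.2 _ (hclamp x) _ (hclamp y) fun j => max_le_max le_rfl (min_le_min le_rfl (hxy j))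
  have hnull : NullMeasurable (fun x => f (clamp x)) (volume : Measure (Fin d → ℝ)) :=
    measurable_of_Ioi (δ := NullMeasurableSpace (Fin d → ℝ) volume) fun t =>
      Set.OrdConnected.nullMeasurableSet (IsUpperSet.ordConnected
        fun x y hxy (hx : t < f (clamp x)) => hx.trans_le (hmono hxy))
  have hae : AEMeasurable (fun x => f (clamp x)) (volume : Measure (Fin d → ℝ)) :=
    hnull.aemeasurable
  refine ⟨fun x => max (-1) (min 1 (hae.mk _ x)),
    measurable_const.max (measurable_const.min hae.measurable_mk),
    fun x => ⟨le_max_left _ _, max_le (by norm_num) (min_le_left _ _)⟩, ?_⟩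
  filter_upwards [ae_restrict_of_ae hae.ae_eq_mk, ae_restrict_mem (measurableSet_unitCube d)]
    with x hx hxc
  rw [← hx, hclamp_eq x hxc, min_eq_right (hf.1 x hxc).2, max_eq_right (hf.1 x hxc).1]

lemma sgn_sub_mem_FMonPM {d : ℕ} {f : (Fin d → ℝ) → ℝ} (hf : f ∈ FMon d) (t : ℝ) :
    (fun y => sgn (f y - t)) ∈ FMonPM d := by
  refine ⟨⟨fun x _ => ?_, fun x hx y hy hxy => ?_⟩, fun x _ => sgn_eq_neg_one_or_one _⟩
  · exact abs_le.1 (abs_sgn _).le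
  · exact monotone_sgn (sub_le_sub_right (hf.2 x hx y hy hxy) t)

lemma intervalIntegrable_sgn_comp {u : ℝ → ℝ} (hu : Measurable u) (a b : ℝ) :
    IntervalIntegrable (fun t => sgn (u t)) volume a b := by
  refine (intervalIntegrable_const (c := (1 : ℝ))).mono_fun
    (measurable_sgn.comp hu).aestronglyMeasurable (Filter.Eventually.of_forall fun t => ?_)
  simp [Real.norm_eq_abs, abs_sgn]

lemma integral_sgn_sub {y : ℝ} (hy : y ∈ Set.Icc (-1 : ℝ) 1) :
    ∫ t in (-1 : ℝ)..1, sgn (y - t) = 2 * y := by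
  have hm : Measurable fun t : ℝ => y - t := measurable_const.sub measurable_id
  rw [← intervalIntegral.integral_add_adjacent_intervals
    (intervalIntegrable_sgn_comp hm (-1) y) (intervalIntegrable_sgn_comp hm y 1)]
  have h1 : ∫ t in (-1 : ℝ)..y, sgn (y - t) = ∫ t in (-1 : ℝ)..y, (1 : ℝ) := by
    refine intervalIntegral.integral_congr fun t ht => ?_
    rw [Set.uIcc_of_le hy.1] at ht
    exact if_pos (sub_nonneg.2 ht.2)
  have h2 : ∫ t in y..1, sgn (y - t) = ∫ t in y..1, (-1 : ℝ) := by
    refine intervalIntegral.integral_congr_ae (Filter.Eventually.of_forall fun t ht => ?_)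
    rw [Set.uIoc_of_le hy.2] at ht
    exact if_neg (by linarith [ht.1])
  rw [h1, h2]
  simp only [intervalIntegral.integral_const, smul_eq_mul]
  ring

lemma measurable_linAlg_sgn {d n k r : ℕ} {f : (Fin d → ℝ) → ℝ} (hf : Measurable f) :
    Measurable fun p : ((Fin n → (Fin d → ℝ)) × ℝ) × (Fin d → ℝ) =>
      linAlg d n k r p.1.1 (fun y => sgn (f y - p.1.2)) p.2 := by
  unfold linAlg
  refine Finset.measurable_sum _ fun α _ => ((Finset.measurable_sum _ fun i _ => ?_).const_mul
    _).mul ((measurable_haar _).comp measurable_snd)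
  have hξ : Measurable fun p : ((Fin n → (Fin d → ℝ)) × ℝ) × (Fin d → ℝ) => p.1.1 i :=
    (measurable_pi_apply i).comp (measurable_fst.comp measurable_fst)
  exact ((measurable_haar _).comp hξ).mul
    (measurable_sgn.comp ((hf.comp hξ).sub (measurable_snd.comp measurable_fst)))

/-- The error of the averaged method is at most the averaged error over the level sets. -/
lemma ofReal_abs_barAlg_sub_le {d n k r : ℕ} {f : (Fin d → ℝ) → ℝ} (hf : Measurable f)
    (ξ : Fin n → (Fin d → ℝ)) {x : Fin d → ℝ} (hx : f x ∈ Set.Icc (-1 : ℝ) 1) :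
    ENNReal.ofReal |barAlg d n k r ξ f x - f x| ≤
      ENNReal.ofReal (1 / 2) * ∫⁻ t in Set.Ioc (-1 : ℝ) 1,
        ENNReal.ofReal |hatAlg d n k r ξ (fun y => sgn (f y - t)) x - sgn (f x - t)| := by
  have hpair : Measurable fun t : ℝ => ((ξ, t), x) := by fun_prop
  have hlin : Measurable fun t : ℝ => linAlg d n k r ξ (fun y => sgn (f y - t)) x := by
    have := (measurable_linAlg_sgn (n := n) (k := k) (r := r) hf).comp hpair
    exact this
  have hi := intervalIntegrable_sgn_comp hlin (-1) 1
  have hj := intervalIntegrable_sgn_comp (u := fun t => f x - t)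
    (measurable_const.sub measurable_id) (-1) 1
  have heq : barAlg d n k r ξ f x - f x = 1 / 2 * ∫ t in (-1 : ℝ)..1,
      (hatAlg d n k r ξ (fun y => sgn (f y - t)) x - sgn (f x - t)) := by
    have := intervalIntegral.integral_sub hi hj
    rw [integral_sgn_sub hx] at this
    simp only [barAlg, hatAlg]
    rw [this]
    ring
  have hint : IntegrableOn
      (fun t => hatAlg d n k r ξ (fun y => sgn (f y - t)) x - sgn (f x - t))
      (Set.Ioc (-1 : ℝ) 1) :=
    (intervalIntegrable_iff_integrableOn_Ioc_of_le (by norm_num)).1 (hi.sub hj)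
  rw [heq, abs_mul, abs_of_pos (by norm_num : (0 : ℝ) < 1 / 2),
    ENNReal.ofReal_mul (by norm_num), ← ofReal_integral_eq_lintegral_ofReal hint.abs
    (Filter.Eventually.of_forall fun _ => abs_nonneg _)]
  gcongr
  rw [intervalIntegral.integral_of_le (by norm_num)]
  exact abs_integral_le_integral_abs

lemma barAlg_congr {d n k r : ℕ} {ξ : Fin n → (Fin d → ℝ)} {f f' : (Fin d → ℝ) → ℝ}
    (h : ∀ i, f (ξ i) = f' (ξ i)) : barAlg d n k r ξ f = barAlg d n k r ξ f' := by
  funext x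
  simp only [barAlg, hatAlg, linAlg, h]

lemma lintegral_dist1e_barAlg_le {d n k r : ℕ} (hn : 1 ≤ n) (hk : 1 ≤ k) (hkd : k ≤ d)
    {f : (Fin d → ℝ) → ℝ} (hf : f ∈ FMon d) :
    ∫⁻ ξ, dist1e (barAlg d n k r ξ f) f ∂sampleMeasure d n ≤
      ENNReal.ofReal (2 * ((d : ℝ) / 2 ^ r) + 2 * (Real.sqrt ((d : ℝ) * r) / ((k : ℝ) + 1)) +
        2 * (Real.exp ((k : ℝ) * (1 + Real.log ((d : ℝ) / k) + Real.log 2 * r)) / n)) := by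
  obtain ⟨f', hf'm, hf'1, hff⟩ := exists_measurable_ae_eq_of_mem_FMon hf
  have : IsProbabilityMeasure (sampleMeasure d n) := by unfold sampleMeasure; infer_instance
  have hξ : ∀ᵐ ξ ∂sampleMeasure d n, ∀ i, f (ξ i) = f' (ξ i) := by
    rw [ae_all_iff]
    intro i
    exact (measurePreserving_eval (fun _ : Fin n => volume.restrict (unitCube d))
      i).quasiMeasurePreserving.ae hff.symm
  have hcongr : ∫⁻ ξ, dist1e (barAlg d n k r ξ f) f ∂sampleMeasure d n =
      ∫⁻ ξ, dist1e (barAlg d n k r ξ f') f' ∂sampleMeasure d n := by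
    refine lintegral_congr_ae (hξ.mono fun ξ h => ?_)
    simp only [dist1e]
    rw [barAlg_congr h]
    refine lintegral_congr_ae (hff.mono fun x hx => ?_)
    simp only [hx]
  let H : ((Fin n → (Fin d → ℝ)) × ℝ) × (Fin d → ℝ) → ℝ≥0∞ := fun p =>
    ENNReal.ofReal |hatAlg d n k r p.1.1 (fun y => sgn (f' y - p.1.2)) p.2 - sgn (f' p.2 - p.1.2)|
  have hH : Measurable H :=
    ((measurable_sgn.comp (measurable_linAlg_sgn hf'm)).sub (measurable_sgn.comp
      ((hf'm.comp measurable_snd).sub (measurable_snd.comp measurable_fst)))).abs.ennreal_ofReal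
  rw [hcongr]
  calc ∫⁻ ξ, dist1e (barAlg d n k r ξ f') f' ∂sampleMeasure d n
      ≤ ∫⁻ ξ, (ENNReal.ofReal (1 / 2) * ∫⁻ t in Set.Ioc (-1 : ℝ) 1,
          ∫⁻ x in unitCube d, H ((ξ, t), x)) ∂sampleMeasure d n := by
        refine lintegral_mono fun ξ => ?_
        have hm : Measurable fun p : (Fin d → ℝ) × ℝ => H ((ξ, p.2), p.1) :=
          hH.comp ((measurable_const.prodMk measurable_snd).prodMk measurable_fst)
        rw [lintegral_lintegral_swap (f := fun t x => H ((ξ, t), x))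
          (hm.comp measurable_swap).aemeasurable,
          ← lintegral_const_mul _ hm.lintegral_prod_right']
        exact lintegral_mono fun x => ofReal_abs_barAlg_sub_le hf'm ξ (hf'1 x)
    _ = ENNReal.ofReal (1 / 2) * ∫⁻ t in Set.Ioc (-1 : ℝ) 1, ∫⁻ ξ,
          dist1e (hatAlg d n k r ξ fun y => sgn (f' y - t)) (fun y => sgn (f' y - t))
            ∂sampleMeasure d n := by
        have hm : Measurable fun p : (Fin n → (Fin d → ℝ)) × ℝ =>
            ∫⁻ x in unitCube d, H (p, x) := hH.lintegral_prod_right'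
        rw [lintegral_const_mul _ hm.lintegral_prod_right',
          lintegral_lintegral_swap hm.aemeasurable]
        rfl
    _ ≤ ENNReal.ofReal (1 / 2) * ∫⁻ _ in Set.Ioc (-1 : ℝ) 1, ENNReal.ofReal
        (2 * ((d : ℝ) / 2 ^ r) + 2 * (Real.sqrt ((d : ℝ) * r) / ((k : ℝ) + 1)) +
        2 * (Real.exp ((k : ℝ) * (1 + Real.log ((d : ℝ) / k) + Real.log 2 * r)) / n)) := by
        gcongr with t
        exact lintegral_dist1e_hatAlg_le hn hk hkd
          (measurable_sgn.comp (hf'm.sub measurable_const))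
          (fun _ => sgn_eq_neg_one_or_one _) (sgn_sub_mem_FMonPM hf t)
          (hff.mono fun x hx => by simp only [hx])
    _ = _ := by
        rw [lintegral_const, Measure.restrict_apply_univ, Real.volume_Ioc, mul_left_comm,
          ← ENNReal.ofReal_mul (by norm_num)]
        norm_num

/-- For `d ≥ 1`, `n ≥ 1`, `1 ≤ k ≤ d` and `r ≥ 1`, the Monte Carlo method
`Ā_{n,k,r}` (with `n` i.i.d. uniform samples) satisfies the worst-case expected error bound
`sup_{f∈F_mon^d} E‖Ā_{n,k,r}(f) - f‖_{L₁}
  ≤ 5d/2^r + 4√(dr)/(k+1) + 4·exp[k(1 + log(d/k) + (log 2)·r)]/n`. -/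
theorem statement11 (d n k r : ℕ) (hd : 1 ≤ d) (hn : 1 ≤ n)
    (hk : 1 ≤ k) (hkd : k ≤ d) (hr : 1 ≤ r) :
    (⨆ f : FMon d, ∫⁻ ξ, dist1e (barAlg d n k r ξ f.1) f.1 ∂sampleMeasure d n)
      ≤ ENNReal.ofReal (5 * (d : ℝ) / 2 ^ r + 4 * Real.sqrt ((d : ℝ) * r) / ((k : ℝ) + 1) +
          4 * Real.exp ((k : ℝ) * (1 + Real.log ((d : ℝ) / k) + Real.log 2 * r)) / n) := by
  refine iSup_le fun f => (lintegral_dist1e_barAlg_le hn hk hkd f.2).trans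
    (ENNReal.ofReal_le_ofReal ?_)
  simp only [← mul_div_assoc]
  gcongr <;> norm_num

end
end

section
/- Let d ≥ 1 and let α ≤ β be real numbers with β − α ≥ 2/√d. Set a = ⌈d/2 + α√d/2⌉ and b = ⌊d/2 + β√d/2⌋. Then the normalized binomial tail sum satisfies 2^{−d}·Σ_{k=a}^{b} C(d,k) ≥ Φ(β) − Φ(α) − 2·C₀/√d, where Φ is the cumulative distribution function of the standard normal distribution and C₀ = 0.4748. -/
open MeasureTheory

noncomputable section

/-- The cumulative distribution function of the standard normal distribution. -/
def stdNormalCDF (x : ℝ) : ℝ :=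
  ∫ t in Set.Iic x, Real.exp (-t ^ 2 / 2) / Real.sqrt (2 * Real.pi)

/-- The mass that the standard normal distribution gives to `[0, x]` (signed for `x < 0`). -/
def stdNormalMass (x : ℝ) : ℝ :=
  ∫ t in (0 : ℝ)..x, Real.exp (-t ^ 2 / 2) / Real.sqrt (2 * Real.pi)

lemma continuous_gaussDensity :
    Continuous fun t : ℝ => Real.exp (-t ^ 2 / 2) / Real.sqrt (2 * Real.pi) := by
  fun_prop

lemma integrable_gaussDensity :
    Integrable fun t : ℝ => Real.exp (-t ^ 2 / 2) / Real.sqrt (2 * Real.pi) := by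
  have h := (integrable_exp_neg_mul_sq (b := 1 / 2) (by norm_num)).div_const
    (Real.sqrt (2 * Real.pi))
  refine h.congr (Filter.Eventually.of_forall fun t => ?_)
  simp only
  congr 2
  ring

lemma stdNormalCDF_sub (x y : ℝ) :
    stdNormalCDF y - stdNormalCDF x = stdNormalMass y - stdNormalMass x := by
  have hi := integrable_gaussDensity
  unfold stdNormalCDF stdNormalMass
  rw [intervalIntegral.integral_Iic_sub_Iic hi.integrableOn hi.integrableOn,
    intervalIntegral.integral_interval_sub_left hi.intervalIntegrable hi.intervalIntegrable]

lemma hasDerivAt_stdNormalMass (x : ℝ) :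
    HasDerivAt stdNormalMass (Real.exp (-x ^ 2 / 2) / Real.sqrt (2 * Real.pi)) x :=
  (continuous_gaussDensity.integral_hasStrictDerivAt 0 x).hasDerivAt

lemma stdNormalMass_zero : stdNormalMass 0 = 0 := by
  simp [stdNormalMass]

lemma stdNormalMass_neg (x : ℝ) : stdNormalMass (-x) = -stdNormalMass x := by
  unfold stdNormalMass
  have h := intervalIntegral.integral_comp_neg (a := 0) (b := x)
    (fun t : ℝ => Real.exp (-t ^ 2 / 2) / Real.sqrt (2 * Real.pi))
  simp only [neg_sq, neg_zero] at h
  rw [h, ← intervalIntegral.integral_symm]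

lemma stdNormalMass_strictMono : StrictMono stdNormalMass := by
  refine strictMono_of_deriv_pos fun x => ?_
  rw [(hasDerivAt_stdNormalMass x).deriv]
  positivity

lemma stdNormalMass_nonneg {x : ℝ} (hx : 0 ≤ x) : 0 ≤ stdNormalMass x :=
  stdNormalMass_zero ▸ stdNormalMass_strictMono.monotone hx

lemma stdNormalMass_le_half (x : ℝ) : stdNormalMass x ≤ 1 / 2 := by
  rcases le_total x 0 with hx | hx
  · have := stdNormalMass_strictMono.monotone hx
    rw [stdNormalMass_zero] at this
    linarith
  have h : ∫ t in Set.Ioi (0 : ℝ), Real.exp (-t ^ 2 / 2) / Real.sqrt (2 * Real.pi) = 1 / 2 := by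
    have h2 := integral_gaussian_Ioi (1 / 2)
    have h3 : ∀ t : ℝ, -(1 / 2 : ℝ) * t ^ 2 = -t ^ 2 / 2 := fun t => by ring
    simp only [h3] at h2
    rw [integral_div, h2, show Real.pi / (1 / 2) = 2 * Real.pi by ring]
    have : 0 < Real.sqrt (2 * Real.pi) := by positivity
    field_simp
  rw [← h, stdNormalMass, intervalIntegral.integral_of_le hx]
  refine setIntegral_mono_set integrable_gaussDensity.integrableOn
    (Filter.Eventually.of_forall fun t => by positivity) ?_
  exact (Set.Ioc_subset_Ioi_self).eventuallyLE

/-- The mean value inequality for `stdNormalMass` on an interval where `C` bounds the density. -/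
lemma stdNormalMass_sub_le {x y C : ℝ} (hxy : x ≤ y)
    (hC : ∀ t, x < t → Real.exp (-t ^ 2 / 2) / Real.sqrt (2 * Real.pi) ≤ C) :
    stdNormalMass y - stdNormalMass x ≤ C * (y - x) := by
  refine (convex_Icc x y).image_sub_le_mul_sub_of_deriv_le
    (fun t _ => (hasDerivAt_stdNormalMass t).continuousAt.continuousWithinAt)
    (fun t _ => (hasDerivAt_stdNormalMass t).differentiableAt.differentiableWithinAt)
    (fun t ht => ?_) x (Set.left_mem_Icc.2 hxy) y (Set.right_mem_Icc.2 hxy) hxy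
  rw [interior_Icc] at ht
  rw [(hasDerivAt_stdNormalMass t).deriv]
  exact hC t ht.1

lemma stdNormalMass_sub_le_div {x y : ℝ} (hxy : x ≤ y) :
    stdNormalMass y - stdNormalMass x ≤ (y - x) / Real.sqrt (2 * Real.pi) := by
  refine (stdNormalMass_sub_le hxy (C := 1 / Real.sqrt (2 * Real.pi)) fun t _ => ?_).trans_eq
    (by ring)
  gcongr
  rw [Real.exp_le_one_iff]
  nlinarith [sq_nonneg t]

lemma le_stdNormalMass {x : ℝ} (hx : 0 ≤ x) :
    (x - x ^ 3 / 6) / Real.sqrt (2 * Real.pi) ≤ stdNormalMass x := by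
  have hd : ∀ t : ℝ, HasDerivAt
      (fun t => stdNormalMass t - (t - t ^ 3 / 6) / Real.sqrt (2 * Real.pi))
      (Real.exp (-t ^ 2 / 2) / Real.sqrt (2 * Real.pi)
        - (1 - t ^ 2 / 2) / Real.sqrt (2 * Real.pi)) t := fun t => by
    refine (hasDerivAt_stdNormalMass t).sub (HasDerivAt.div_const ?_ _)
    convert! (hasDerivAt_id t).sub ((hasDerivAt_pow 3 t).div_const 6) using 1
    norm_num
    ring
  have hm : Monotone (fun t => stdNormalMass t - (t - t ^ 3 / 6) / Real.sqrt (2 * Real.pi)) := by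
    refine monotone_of_deriv_nonneg (fun t => (hd t).differentiableAt) fun t => ?_
    rw [(hd t).deriv, ← sub_div]
    have := Real.add_one_le_exp (-t ^ 2 / 2)
    exact div_nonneg (by linarith) (Real.sqrt_nonneg _)
  have h0 : (0 - (0 : ℝ) ^ 3 / 6) / Real.sqrt (2 * Real.pi) = 0 := by norm_num
  have := hm hx
  simp only [stdNormalMass_zero, h0] at this
  linarith

/-- Rescaling the argument by `r ≥ 1` changes the mass by at most a multiple of `r - 1`. -/
lemma stdNormalMass_mul_sub_le {z r : ℝ} (hz : 0 ≤ z) (hr : 1 ≤ r) :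
    stdNormalMass (r * z) - stdNormalMass z
      ≤ 0.7072 * (r - 1) / Real.sqrt (2 * Real.pi) := by
  have hs : 0 < Real.sqrt (2 * Real.pi) := by positivity
  have h1 : z * Real.exp (-z ^ 2 / 2) ≤ 0.7072 := by
    have h2 := Real.add_one_le_exp (z ^ 2 / 2)
    have h3 : Real.exp (-z ^ 2 / 2) * Real.exp (z ^ 2 / 2) = 1 := by
      rw [← Real.exp_add]
      simp [neg_div]
    have h4 := Real.exp_pos (-z ^ 2 / 2)
    have h5 : z ≤ 0.7072 * Real.exp (z ^ 2 / 2) := by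
      nlinarith [sq_nonneg (z - 1.4142)]
    nlinarith
  have h := stdNormalMass_sub_le (x := z) (y := r * z)
    (C := Real.exp (-z ^ 2 / 2) / Real.sqrt (2 * Real.pi)) (by nlinarith) fun t ht => by
      gcongr
  refine h.trans ?_
  rw [div_mul_eq_mul_div, div_le_div_iff_of_pos_right hs]
  nlinarith

lemma sinh_le_self_mul_cosh {a : ℝ} (ha : 0 ≤ a) : Real.sinh a ≤ a * Real.cosh a := by
  have hd : ∀ t : ℝ, HasDerivAt (fun t => t * Real.cosh t - Real.sinh t) (t * Real.sinh t) t :=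
    fun t => by
      convert! ((hasDerivAt_id t).mul (Real.hasDerivAt_cosh t)).sub (Real.hasDerivAt_sinh t) using 1
      simp
  have hm : Monotone (fun t => t * Real.cosh t - Real.sinh t) := by
    refine monotone_of_deriv_nonneg (fun t => (hd t).differentiableAt) fun t => ?_
    rw [(hd t).deriv]
    rcases le_total 0 t with h | h
    · exact mul_nonneg h (Real.sinh_nonneg_iff.2 h)
    · exact mul_nonneg_of_nonpos_of_nonpos h (Real.sinh_nonpos_iff.2 h)
  have := hm ha
  simp at this
  linarith

lemma cosh_sub_one_le {a b : ℝ} (ha : 0 ≤ a) (hab : a ≤ b) :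
    Real.cosh (2 * a) - 1 ≤ b * Real.sinh (2 * a) := by
  have h1 := sinh_le_self_mul_cosh ha
  have h2 := Real.sinh_nonneg_iff.2 ha
  have h3 := Real.cosh_pos a
  rw [Real.cosh_two_mul, Real.sinh_two_mul, Real.cosh_sq]
  have h4 : Real.sinh a ≤ b * Real.cosh a := h1.trans (by gcongr)
  nlinarith

/-- Ratios of consecutive cells of width `2` under a centred Gaussian of variance `D`
dominate `(D - t) / (D + t)`. -/
lemma gaussian_cell_ratio {D c t : ℝ} {Ψ : ℝ → ℝ} (hD : 0 < D) (hc : 0 ≤ c) (ht : 0 ≤ t)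
    (hΨ : ∀ u, HasDerivAt Ψ (c * Real.exp (-u ^ 2 / (2 * D))) u) (hodd : ∀ u, Ψ (-u) = -Ψ u) :
    (D - t) * (Ψ t - Ψ (t - 2)) ≤ (D + t) * (Ψ (t + 2) - Ψ t) := by
  rcases ht.eq_or_lt with rfl | ht
  · have h0 : Ψ 0 = 0 := by
      have := hodd 0
      rw [neg_zero] at this
      linarith
    simp [hodd, h0]
  set τ := t / D with hτ
  have hτ0 : 0 < τ := by positivity
  have htD : t = τ * D := by rw [hτ]; field_simp
  set e := c * Real.exp (-t ^ 2 / (2 * D)) with he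
  have he0 : 0 ≤ e := by positivity
  let w : ℝ → ℝ := fun v => Real.exp (-v ^ 2 / (2 * D))
  have hw : ∀ v, HasDerivAt w (w v * (-v / D)) v := fun v => by
    have : HasDerivAt (fun v : ℝ => -v ^ 2 / (2 * D)) (-v / D) v := by
      convert! ((hasDerivAt_pow 2 v).neg).div_const (2 * D) using 1
      field_simp
      norm_num
      ring
    exact this.exp
  let G : ℝ → ℝ := fun v => Real.cosh (τ * v) - 1 - τ * Real.sinh (τ * v)
  have hG : ∀ v, HasDerivAt G (τ * (Real.sinh (τ * v) - τ * Real.cosh (τ * v))) v := fun v => by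
    have h1 : HasDerivAt (fun v : ℝ => τ * v) τ v := by
      simpa using (hasDerivAt_id v).const_mul τ
    convert! (h1.cosh.sub_const 1).sub (h1.sinh.const_mul τ) using 1
    ring
  let K : ℝ → ℝ := fun v => (D + t) * (Ψ (t + v) - Ψ t) - (D - t) * (Ψ t - Ψ (t - v))
  have hplus : ∀ v, c * Real.exp (-(t + v) ^ 2 / (2 * D)) = e * w v * Real.exp (-(τ * v)) :=
    fun v => by
      rw [he, mul_assoc, mul_assoc, ← Real.exp_add, ← Real.exp_add]
      congr 2
      rw [hτ]
      field_simp
      ring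
  have hminus : ∀ v, c * Real.exp (-(t - v) ^ 2 / (2 * D)) = e * w v * Real.exp (τ * v) :=
    fun v => by
      rw [he, mul_assoc, mul_assoc, ← Real.exp_add, ← Real.exp_add]
      congr 2
      rw [hτ]
      field_simp
      ring
  have hK : ∀ v, HasDerivAt K
      (-(2 * D) * (e * w v) * (Real.sinh (τ * v) - τ * Real.cosh (τ * v))) v := fun v => by
    have h1 := (((hΨ (t + v)).comp_const_add t v).sub_const (Ψ t)).const_mul (D + t)
    have h2 := (((hΨ (t - v)).comp_const_sub t v).const_sub (Ψ t)).const_mul (D - t)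
    convert! h1.sub h2 using 1
    rw [hplus, neg_neg, hminus, Real.sinh_eq, Real.cosh_eq, htD]
    ring
  let F : ℝ → ℝ := fun v => τ * K v + 2 * D * e * (G v * w v)
  have hF : ∀ v, HasDerivAt F (2 * e * w v * v * -G v) v := fun v => by
    convert! ((hK v).const_mul τ).add (((hG v).mul (hw v)).const_mul (2 * D * e)) using 1
    field_simp
    ring
  have hGle : ∀ v ∈ Set.Icc (0 : ℝ) 2, G v ≤ 0 := fun v hv => by
    have := cosh_sub_one_le (a := τ * v / 2) (b := τ) (by nlinarith [hv.1]) (by nlinarith [hv.2])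
    rw [show 2 * (τ * v / 2) = τ * v by ring] at this
    simp only [G]
    linarith
  have hmono : MonotoneOn F (Set.Icc 0 2) := by
    refine monotoneOn_of_deriv_nonneg (convex_Icc 0 2)
      (fun v _ => (hF v).continuousAt.continuousWithinAt)
      (fun v _ => (hF v).differentiableAt.differentiableWithinAt) fun v hv => ?_
    have hv' := interior_subset hv
    rw [(hF v).deriv]
    have := hGle v hv'
    have h3 : 0 ≤ w v := (Real.exp_pos _).le
    exact mul_nonneg (mul_nonneg (by positivity) hv'.1) (by linarith)
  have h := hmono (Set.left_mem_Icc.2 zero_le_two) (Set.right_mem_Icc.2 zero_le_two) zero_le_two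
  have hF0 : F 0 = 0 := by simp [F, K, G]
  have hG2 := hGle 2 (Set.right_mem_Icc.2 zero_le_two)
  have hw2 : 0 ≤ w 2 := (Real.exp_pos _).le
  have h4 : 0 ≤ 2 * D * e * (-G 2 * w 2) := by
    have : 0 ≤ -G 2 := by linarith
    positivity
  have hK2 : 0 ≤ τ * K 2 := by
    simp only [hF0] at h
    simp only [F] at h
    linarith
  have := nonneg_of_mul_nonneg_right hK2 hτ0
  simp only [K] at this
  linarith

lemma centralBinom_sq_le (n : ℕ) :
    ((n.centralBinom : ℝ) / 4 ^ n) ^ 2 * (n + 1 / 4) ≤ 1 / Real.pi := by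
  let u : ℕ → ℝ := fun n => ((n.centralBinom : ℝ) / 4 ^ n) ^ 2 * (n + 1 / 4)
  have hmono : Monotone u := monotone_nat_of_le_succ fun n => by
    have h : (n + 1 : ℝ) * (n + 1).centralBinom = 2 * (2 * n + 1) * n.centralBinom := by
      exact_mod_cast Nat.succ_mul_centralBinom_succ n
    have h' : ((n + 1).centralBinom : ℝ) / 4 ^ (n + 1)
        = (n.centralBinom : ℝ) / 4 ^ n * ((2 * n + 1) / (2 * n + 2)) := by
      rw [pow_succ]
      field_simp
      linarith
    simp only [u]
    rw [h', mul_pow, mul_assoc]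
    gcongr
    rw [div_pow, div_mul_eq_mul_div, le_div_iff₀ (by positivity)]
    push_cast
    nlinarith
  have hu : ∀ n, u n = (Real.Wallis.W n)⁻¹ * ((n + 1 / 4) / (2 * n + 1)) := fun n => by
    have hf : (n.centralBinom : ℝ) = (2 * n).factorial / (n.factorial : ℝ) ^ 2 := by
      rw [Nat.centralBinom_eq_two_mul_choose, Nat.cast_choose ℝ (by omega),
        show 2 * n - n = n by omega, sq]
    simp only [u]
    rw [Real.Wallis.W_eq_factorial_ratio, hf, show (4 : ℝ) = 2 ^ 2 by norm_num, ← pow_mul]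
    have : (n.factorial : ℝ) ≠ 0 := by positivity
    have : ((2 * n).factorial : ℝ) ≠ 0 := by positivity
    field_simp
    ring
  have hlim : Filter.Tendsto (fun n : ℕ => ((n : ℝ) + 1 / 4) / (2 * n + 1)) Filter.atTop
      (nhds (1 / 2)) := by
    have h1 : ∀ n : ℕ, ((n : ℝ) + 1 / 4) / (2 * n + 1) = 1 / 2 - 1 / 8 * (1 / ((n : ℝ) + 1 / 2)) :=
      fun n => by field_simp; ring
    simp only [h1]
    have h2 : Filter.Tendsto (fun n : ℕ => 1 / ((n : ℝ) + 1 / 2)) Filter.atTop (nhds 0) :=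
      tendsto_const_nhds.div_atTop
        (Filter.tendsto_atTop_add_const_right _ _ tendsto_natCast_atTop_atTop)
    have h3 := (h2.const_mul (1 / 8 : ℝ)).const_sub (1 / 2)
    rwa [mul_zero, sub_zero] at h3
  have hT : Filter.Tendsto u Filter.atTop (nhds (1 / Real.pi)) := by
    have := (Real.Wallis.tendsto_W_nhds_pi_div_two.inv₀ (by positivity)).mul hlim
    rw [show u = fun n => (Real.Wallis.W n)⁻¹ * (((n : ℝ) + 1 / 4) / (2 * n + 1)) from funext hu]
    convert this using 2
    field_simp
  exact hmono.ge_of_tendsto hT n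

/-- The symmetric binomial distribution with `d` trials. -/
def binomProb (d j : ℕ) : ℝ := (d.choose j : ℝ) / 2 ^ d

/-- The probability of at least `m` successes in `d` fair trials. -/
def binomTail (d m : ℕ) : ℝ := ∑ j ∈ Finset.Ico m (d + 1), binomProb d j

/-- The left end of the `i`-th cell of length `2` around `2 * i - d`, measured through the centred
Gaussian of variance `d + 1`. -/
def cellBound (d i : ℕ) : ℝ := stdNormalMass ((2 * i - d - 1) / Real.sqrt (d + 1))

/-- The mass of the cell `[2 * i - d - 1, 2 * i - d + 1]` under the centred Gaussian of
variance `d + 1`. -/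
def cellMass (d i : ℕ) : ℝ := cellBound d (i + 1) - cellBound d i

lemma binomProb_nonneg (d j : ℕ) : 0 ≤ binomProb d j := by
  unfold binomProb; positivity

lemma binomProb_symm {d j : ℕ} (hj : j ≤ d) : binomProb d (d - j) = binomProb d j := by
  rw [binomProb, Nat.choose_symm hj, binomProb]

lemma sum_binomProb (d : ℕ) : ∑ j ∈ Finset.range (d + 1), binomProb d j = 1 := by
  have h : (∑ j ∈ Finset.range (d + 1), (d.choose j : ℝ)) = 2 ^ d := by
    exact_mod_cast Nat.sum_range_choose d
  simp only [binomProb]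
  rw [← Finset.sum_div, h, div_self (by positivity)]

lemma sum_range_binomProb {d m : ℕ} (hm : m ≤ d + 1) :
    ∑ j ∈ Finset.range m, binomProb d j = binomTail d (d + 1 - m) := by
  have h := Finset.sum_Ico_reflect (binomProb d) 0 hm
  rw [Nat.sub_zero] at h
  rw [binomTail, ← h, Finset.range_eq_Ico]
  refine Finset.sum_congr rfl fun j hj => (binomProb_symm ?_).symm
  have := (Finset.mem_Ico.1 hj).2
  omega

lemma sum_range_add_binomTail {d m : ℕ} (hm : m ≤ d + 1) :
    ∑ j ∈ Finset.range m, binomProb d j + binomTail d m = 1 := by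
  rw [binomTail, Finset.sum_range_add_sum_Ico _ hm, sum_binomProb]

lemma sum_Ico_cellMass {d m n : ℕ} (h : m ≤ n) :
    ∑ i ∈ Finset.Ico m n, cellMass d i = cellBound d n - cellBound d m :=
  Finset.sum_Ico_sub (cellBound d) h

lemma cellBound_symm {d i : ℕ} (hi : i ≤ d + 1) : cellBound d (d + 1 - i) = -cellBound d i := by
  rw [cellBound, cellBound, ← stdNormalMass_neg, Nat.cast_sub hi]
  congr 1
  push_cast
  ring

lemma cellMass_symm {d i : ℕ} (hi : i ≤ d) : cellMass d (d - i) = cellMass d i := by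
  have h := cellBound_symm (d := d) (i := i + 1) (by omega)
  have h' := cellBound_symm (d := d) (i := i) (by omega)
  rw [show d + 1 - (i + 1) = d - i by omega] at h
  rw [show d + 1 - i = d - i + 1 by omega] at h'
  rw [cellMass, cellMass, h, h']
  ring

lemma cellMass_pos (d i : ℕ) : 0 < cellMass d i := by
  refine sub_pos.2 (stdNormalMass_strictMono ?_)
  gcongr
  linarith

lemma binomProb_mul_cellMass_succ {d i : ℕ} (hi : d ≤ 2 * i + 1) :
    binomProb d (i + 1) * cellMass d i ≤ binomProb d i * cellMass d (i + 1) := by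
  rcases le_or_gt d i with hdi | hdi
  · have : binomProb d (i + 1) = 0 := by
      simp [binomProb, Nat.choose_eq_zero_of_lt (show d < i + 1 by omega)]
    rw [this, zero_mul]
    exact mul_nonneg (binomProb_nonneg _ _) (cellMass_pos _ _).le
  have hD : (0 : ℝ) < d + 1 := by positivity
  have hs : 0 < Real.sqrt (d + 1 : ℝ) := by positivity
  have hs2 : Real.sqrt (d + 1 : ℝ) ^ 2 = d + 1 := Real.sq_sqrt hD.le
  have hi' : (d : ℝ) ≤ 2 * i + 1 := by exact_mod_cast hi
  have hΨ : ∀ u : ℝ, HasDerivAt (fun u => stdNormalMass (u / Real.sqrt (d + 1)))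
      (1 / (Real.sqrt (2 * Real.pi) * Real.sqrt (d + 1))
        * Real.exp (-u ^ 2 / (2 * (d + 1 : ℝ)))) u := fun u => by
    have h1 := (hasDerivAt_stdNormalMass (u / Real.sqrt (d + 1))).comp u
      ((hasDerivAt_id u).div_const (Real.sqrt (d + 1)))
    convert! h1 using 1
    rw [div_pow, hs2, show -(u ^ 2 / (d + 1 : ℝ)) / 2 = -u ^ 2 / (2 * (d + 1)) by field_simp]
    field_simp
  have h := gaussian_cell_ratio (t := 2 * i - d + 1) hD (by positivity) (by linarith) hΨ
    fun u => by rw [neg_div, stdNormalMass_neg]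
  have hp : binomProb d (i + 1) * (i + 1) = binomProb d i * (d - i) := by
    have := Nat.choose_succ_right_eq d i
    have h2 : (d.choose (i + 1) : ℝ) * (i + 1) = d.choose i * (d - i) := by
      rw [← Nat.cast_sub hdi.le]
      exact_mod_cast this
    rw [binomProb, binomProb, div_mul_eq_mul_div, h2, mul_div_right_comm]
  have hq : (d - i : ℝ) * cellMass d i ≤ (i + 1) * cellMass d (i + 1) := by
    have e1 : cellBound d i = stdNormalMass ((2 * i - d + 1 - 2) / Real.sqrt (d + 1)) := by
      rw [cellBound]; congr 2; ring
    have e2 : cellBound d (i + 1) = stdNormalMass ((2 * i - d + 1) / Real.sqrt (d + 1)) := by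
      rw [cellBound]; congr 2; push_cast; ring
    have e3 : cellBound d (i + 1 + 1)
        = stdNormalMass ((2 * i - d + 1 + 2) / Real.sqrt (d + 1)) := by
      rw [cellBound]; congr 2; push_cast; ring
    rw [cellMass, cellMass, e1, e2, e3]
    linarith
  refine le_of_mul_le_mul_left ?_ (show (0 : ℝ) < i + 1 by positivity)
  calc (i + 1 : ℝ) * (binomProb d (i + 1) * cellMass d i)
      = binomProb d i * ((d - i) * cellMass d i) := by
        rw [← mul_assoc, mul_comm (i + 1 : ℝ), hp]
        ring
    _ ≤ binomProb d i * ((i + 1) * cellMass d (i + 1)) :=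
        mul_le_mul_of_nonneg_left hq (binomProb_nonneg _ _)
    _ = (i + 1) * (binomProb d i * cellMass d (i + 1)) := by ring

lemma binomProb_div_cellMass_le {d i j : ℕ} (hi : d ≤ 2 * i + 1) (hij : i ≤ j) :
    binomProb d j / cellMass d j ≤ binomProb d i / cellMass d i := by
  induction j, hij using Nat.le_induction with
  | base => exact le_rfl
  | succ j hij ih =>
    refine le_trans ?_ ih
    rw [div_le_div_iff₀ (cellMass_pos _ _) (cellMass_pos _ _)]
    exact binomProb_mul_cellMass_succ (by omega)

/-- The likelihood ratio of the binomial against the Gaussian cells decreases away from the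
centre, on both sides. -/
lemma binomProb_mul_cellMass_le {d i j : ℕ} (hid : i ≤ d) (hij : i ≤ j) (hij' : d ≤ i + j) :
    binomProb d j * cellMass d i ≤ binomProb d i * cellMass d j := by
  rw [← div_le_div_iff₀ (cellMass_pos _ _) (cellMass_pos _ _)]
  rcases le_total d (2 * i) with h | h
  · exact binomProb_div_cellMass_le (by omega) hij
  · rw [← binomProb_symm hid, ← cellMass_symm hid]
    exact binomProb_div_cellMass_le (by omega) (by omega)

/-- The symmetric binomial tail is dominated by the tail of the Gaussian of variance `d + 1`. -/
lemma binomTail_le_half_sub_cellBound {d m : ℕ} (hm : m ≤ d + 1) (hdm : d < 2 * m) :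
    binomTail d m ≤ 1 / 2 - cellBound d m := by
  set I := Finset.Ico (d + 1 - m) m
  set J := Finset.Ico m (d + 1)
  have hcross : (∑ j ∈ J, binomProb d j) * (∑ i ∈ I, cellMass d i)
      ≤ (∑ i ∈ I, binomProb d i) * (∑ j ∈ J, cellMass d j) := by
    rw [Finset.sum_mul_sum, Finset.sum_mul_sum, Finset.sum_comm]
    refine Finset.sum_le_sum fun i hi => Finset.sum_le_sum fun j hj => ?_
    have hi' := Finset.mem_Ico.1 hi
    have hj' := Finset.mem_Ico.1 hj
    exact binomProb_mul_cellMass_le (by omega) (by omega) (by omega)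
  have h1 : ∑ i ∈ I, binomProb d i = 1 - 2 * binomTail d m := by
    have ha := Finset.sum_range_add_sum_Ico (binomProb d) (show d + 1 - m ≤ m by omega)
    have hb := sum_range_add_binomTail hm
    have hc := sum_range_binomProb (d := d) (m := d + 1 - m) (by omega)
    rw [show d + 1 - (d + 1 - m) = m by omega] at hc
    linarith
  have h2 : ∑ i ∈ I, cellMass d i = 2 * cellBound d m := by
    rw [sum_Ico_cellMass (by omega), cellBound_symm hm]
    ring
  have h3 : ∑ j ∈ J, cellMass d j ≤ 1 / 2 - cellBound d m := by
    rw [sum_Ico_cellMass hm]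
    have : cellBound d (d + 1) ≤ 1 / 2 := stdNormalMass_le_half _
    linarith
  have h4 : 0 ≤ ∑ i ∈ I, binomProb d i := Finset.sum_nonneg fun i _ => binomProb_nonneg d i
  have h5 := hcross.trans (mul_le_mul_of_nonneg_left h3 h4)
  rw [h1, h2, ← binomTail] at h5
  linarith

/-- A likelihood bound at the centre transfers to all central intervals. -/
lemma binomTail_le_half_add_mul_cellBound {d m : ℕ} {ρ : ℝ} (hm : 2 * m ≤ d)
    (hρ : binomProb d ((d + 1) / 2) ≤ ρ * cellMass d ((d + 1) / 2)) :
    binomTail d m ≤ 1 / 2 + ρ * cellBound d (d + 1 - m) := by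
  have hpt : ∀ j ≤ d, binomProb d j ≤ ρ * cellMass d j := by
    have key : ∀ j ≤ d, d ≤ 2 * j → binomProb d j ≤ ρ * cellMass d j := fun j hj hdj => by
      rw [← div_le_iff₀ (cellMass_pos _ _)]
      refine (binomProb_div_cellMass_le (i := (d + 1) / 2) (by omega) (by omega)).trans ?_
      rwa [div_le_iff₀ (cellMass_pos _ _)]
    intro j hj
    rcases le_total d (2 * j) with h | h
    · exact key j hj h
    · rw [← binomProb_symm hj, ← cellMass_symm hj]
      exact key _ (by omega) (by omega)
  have h1 : ∑ i ∈ Finset.Ico m (d + 1 - m), binomProb d i = 2 * binomTail d m - 1 := by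
    have ha := Finset.sum_range_add_sum_Ico (binomProb d) (show m ≤ d + 1 - m by omega)
    have hb := sum_range_add_binomTail (d := d) (m := m) (by omega)
    have hc := sum_range_binomProb (d := d) (m := d + 1 - m) (by omega)
    rw [show d + 1 - (d + 1 - m) = m by omega] at hc
    linarith
  have h2 : ∑ i ∈ Finset.Ico m (d + 1 - m), cellMass d i = 2 * cellBound d (d + 1 - m) := by
    have := cellBound_symm (d := d) (i := m) (by omega)
    rw [sum_Ico_cellMass (by omega)]
    linarith
  have h3 : ∑ i ∈ Finset.Ico m (d + 1 - m), binomProb d i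
      ≤ ∑ i ∈ Finset.Ico m (d + 1 - m), ρ * cellMass d i :=
    Finset.sum_le_sum fun i hi => hpt i (by have := (Finset.mem_Ico.1 hi).2; omega)
  rw [h1, ← Finset.mul_sum, h2] at h3
  linarith

lemma le_sqrt_two_pi : 2.5066 ≤ Real.sqrt (2 * Real.pi) := by
  refine Real.le_sqrt_of_sq_le ?_
  have := Real.pi_gt_d6
  norm_num at this ⊢
  linarith

lemma sqrt_two_pi_le : Real.sqrt (2 * Real.pi) ≤ 2.51 := by
  refine Real.sqrt_le_iff.2 ⟨by norm_num, ?_⟩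
  have := Real.pi_lt_d4
  norm_num at this ⊢
  linarith

lemma binomProb_center_even_sq_le (n : ℕ) :
    binomProb (2 * n) n ^ 2 ≤ 4 / (Real.sqrt (2 * Real.pi) ^ 2 * (2 * n + 1 / 2)) := by
  have h := centralBinom_sq_le n
  have e : binomProb (2 * n) n = (n.centralBinom : ℝ) / 4 ^ n := by
    rw [binomProb, Nat.centralBinom_eq_two_mul_choose, pow_mul]
    norm_num
  rw [e, Real.sq_sqrt (by positivity)]
  rw [← le_div_iff₀ (by positivity)] at h
  refine h.trans_eq ?_
  field_simp
  ring

lemma binomProb_center_odd_sq_le (n : ℕ) :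
    binomProb (2 * n + 1) (n + 1) ^ 2
      ≤ 4 / (Real.sqrt (2 * Real.pi) ^ 2 * (2 * n + 5 / 2)) := by
  have e : binomProb (2 * n + 1) (n + 1) = binomProb (2 * (n + 1)) (n + 1) := by
    have h1 : (2 * (n + 1)).choose (n + 1) = 2 * (2 * n + 1).choose (n + 1) := by
      rw [show 2 * (n + 1) = 2 * n + 1 + 1 by ring, Nat.choose_succ_succ', Nat.choose_symm_half]
      ring
    rw [binomProb, binomProb, h1, show 2 * (n + 1) = 2 * n + 1 + 1 by ring, pow_succ _ (2 * n + 1)]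
    push_cast
    field_simp
  rw [e]
  refine (binomProb_center_even_sq_le (n + 1)).trans_eq ?_
  push_cast
  ring

lemma le_mul_of_sq_le_div {p q s D E X ρ : ℝ} (hs : 0 < s) (hD : 0 < D) (hE : 0 < E)
    (hX : 0 ≤ X) (hρ : 0 ≤ ρ) (hp : p ^ 2 ≤ 4 / (s ^ 2 * E))
    (hq : 2 * (X / Real.sqrt D / s) ≤ q) (hnum : D ≤ E * (ρ * X) ^ 2) : p ≤ ρ * q := by
  have hsD : 0 < Real.sqrt D := Real.sqrt_pos.2 hD
  refine le_trans ?_ (mul_le_mul_of_nonneg_left hq hρ)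
  refine (abs_le_of_sq_le_sq' (hp.trans ?_) (by positivity)).2
  rw [show (ρ * (2 * (X / Real.sqrt D / s))) ^ 2 = 4 * (ρ * X) ^ 2 / (s ^ 2 * Real.sqrt D ^ 2) by
    field_simp; ring, Real.sq_sqrt hD.le, div_le_div_iff₀ (by positivity) (by positivity)]
  nlinarith [mul_le_mul_of_nonneg_left hnum (show 0 ≤ 4 * s ^ 2 by positivity)]

lemma binomProb_center_le {d : ℕ} (hd : 5 ≤ d) :
    binomProb d ((d + 1) / 2) ≤ (1 + 0.42 / d) * cellMass d ((d + 1) / 2) := by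
  have hs : 0 < Real.sqrt (2 * Real.pi) := by positivity
  have hD : (0 : ℝ) < d + 1 := by positivity
  have hr : 0 < Real.sqrt (d + 1 : ℝ) := by positivity
  have hr2 : Real.sqrt (d + 1 : ℝ) ^ 2 = d + 1 := Real.sq_sqrt hD.le
  have hd' : (5 : ℝ) ≤ d := by exact_mod_cast hd
  obtain ⟨x, hx, hdx⟩ : ∃ x : ℝ, 0 ≤ x ∧ (d : ℝ) = x + 5 := ⟨d - 5, by linarith, by ring⟩
  rcases Nat.even_or_odd' d with ⟨n, hn | hn⟩
  · have hc : (d + 1) / 2 = n := by omega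
    have hnd : (d : ℝ) = 2 * n := by exact_mod_cast hn
    have hp := binomProb_center_even_sq_le n
    rw [← hn, ← hnd] at hp
    rw [hc]
    have hl := le_stdNormalMass (x := 1 / Real.sqrt (d + 1)) (by positivity)
    refine le_mul_of_sq_le_div (X := 1 - 1 / (6 * (d + 1))) hs hD (by positivity) ?_
      (by positivity) hp ?_ ?_
    · rw [sub_nonneg, div_le_one (by positivity)]
      linarith
    · have e : cellMass d n = 2 * stdNormalMass (1 / Real.sqrt (d + 1)) := by
        rw [cellMass, cellBound, cellBound, hnd]
        push_cast
        rw [show (2 * n - 2 * n - 1 : ℝ) / Real.sqrt (2 * n + 1) = -(1 / Real.sqrt (2 * n + 1)) by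
          ring, stdNormalMass_neg,
          show (2 * (n + 1) - 2 * n - 1 : ℝ) / Real.sqrt (2 * n + 1) = 1 / Real.sqrt (2 * n + 1) by
          ring]
        ring
      rw [e]
      refine mul_le_mul_of_nonneg_left (le_trans (le_of_eq ?_) hl) zero_le_two
      congr 1
      generalize Real.sqrt (d + 1 : ℝ) = r at hr hr2 ⊢
      rw [← hr2]
      field_simp
    · rw [hdx, ← sub_nonneg]
      field_simp
      ring_nf
      positivity
  · have hc : (d + 1) / 2 = n + 1 := by omega
    have hnd : (d : ℝ) = 2 * n + 1 := by exact_mod_cast hn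
    have hp := binomProb_center_odd_sq_le n
    rw [← hn, show (2 * n + 5 / 2 : ℝ) = d + 3 / 2 by rw [hnd]; ring] at hp
    rw [hc]
    have hl := le_stdNormalMass (x := 2 / Real.sqrt (d + 1)) (by positivity)
    refine le_mul_of_sq_le_div (X := 1 - 2 / (3 * (d + 1))) hs hD (by positivity) ?_
      (by positivity) hp ?_ ?_
    · rw [sub_nonneg, div_le_one (by positivity)]
      linarith
    · have e : cellMass d (n + 1) = stdNormalMass (2 / Real.sqrt (d + 1)) := by
        rw [cellMass, cellBound, cellBound]
        push_cast
        rw [show (2 * (n + 1) - d - 1 : ℝ) = 0 by rw [hnd]; ring,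
          show (2 * (n + 1 + 1) - d - 1 : ℝ) = 2 by rw [hnd]; ring, zero_div, stdNormalMass_zero,
          sub_zero]
      rw [e]
      refine le_trans (le_of_eq ?_) hl
      rw [← mul_div_assoc]
      congr 1
      generalize Real.sqrt (d + 1 : ℝ) = r at hr hr2 ⊢
      rw [← hr2]
      field_simp
      ring
    · rw [hdx, ← sub_nonneg]
      field_simp
      ring_nf
      positivity

lemma error_term_le {c d : ℝ} (hd : 0 < d)
    (h : c * (d + 1) ≤ Real.sqrt d * (0.0758 * (d + 1) + 0.1994)) :
    c / d + 1 / Real.sqrt (d + 1) / Real.sqrt (2 * Real.pi) ≤ 0.4748 / Real.sqrt d := by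
  have hs := le_sqrt_two_pi
  have hx : 0 < Real.sqrt d := Real.sqrt_pos.2 hd
  have hx2 : Real.sqrt d ^ 2 = d := Real.sq_sqrt hd.le
  have hy : 0 < Real.sqrt (d + 1) := by positivity
  have hy2 : Real.sqrt (d + 1) ^ 2 = d + 1 := Real.sq_sqrt (by positivity)
  have h1 : Real.sqrt d / Real.sqrt (d + 1) ≤ 1 - 1 / (2 * (d + 1)) := by
    refine (abs_le_of_sq_le_sq' ?_ ?_).2
    · rw [div_pow, hx2, hy2, ← sub_nonneg]
      field_simp
      ring_nf
      norm_num
    · rw [sub_nonneg, div_le_one (by positivity)]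
      linarith
  have h2 : 1 / Real.sqrt (2 * Real.pi) ≤ 0.39895 := by
    rw [div_le_iff₀ (by positivity)]
    linarith
  have h3 : Real.sqrt d / Real.sqrt (d + 1) * (1 / Real.sqrt (2 * Real.pi))
      ≤ (1 - 1 / (2 * (d + 1))) * 0.39895 :=
    mul_le_mul h1 h2 (by positivity) (le_trans (by positivity) h1)
  have h4 : c / Real.sqrt d ≤ 0.0758 + 0.1994 / (d + 1) := by
    rw [div_le_iff₀ hx, show (0.0758 + 0.1994 / (d + 1)) * Real.sqrt d
      = Real.sqrt d * (0.0758 * (d + 1) + 0.1994) / (d + 1) by field_simp,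
      le_div_iff₀ (by positivity)]
    exact h
  have h5 : 0.1994 / (d + 1) ≤ 1 / (2 * (d + 1)) * 0.39895 := by
    rw [← sub_nonneg]
    field_simp
    norm_num
  rw [le_div_iff₀ hx]
  calc (c / d + 1 / Real.sqrt (d + 1) / Real.sqrt (2 * Real.pi)) * Real.sqrt d
      = c / Real.sqrt d + Real.sqrt d / Real.sqrt (d + 1) * (1 / Real.sqrt (2 * Real.pi)) := by
        have : c / d * Real.sqrt d = c / Real.sqrt d := by
          rw [div_mul_eq_mul_div, div_eq_div_iff hd.ne' hx.ne', mul_assoc, ← sq, hx2]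
        rw [add_mul, this]
        ring
    _ ≤ 0.4748 := by linarith

lemma binomTail_le_of_lt {d m : ℕ} (hd : 1 ≤ d) (hm : m ≤ d + 1) (hdm : d < 2 * m) :
    binomTail d m
      ≤ 1 / 2 - stdNormalMass ((2 * m - d) / Real.sqrt d) + 0.4748 / Real.sqrt d := by
  have hd' : (1 : ℝ) ≤ d := by exact_mod_cast hd
  have hdm' : (d : ℝ) + 1 ≤ 2 * m := by exact_mod_cast hdm
  have hx : 1 ≤ Real.sqrt d := Real.one_le_sqrt.2 hd'
  have hx2 : Real.sqrt d ^ 2 = d := Real.sq_sqrt (by positivity)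
  have hy : 0 < Real.sqrt (d + 1 : ℝ) := by positivity
  have hy2 : Real.sqrt (d + 1 : ℝ) ^ 2 = d + 1 := Real.sq_sqrt (by positivity)
  have hs := le_sqrt_two_pi
  have h1 := binomTail_le_half_sub_cellBound hm hdm
  set s : ℝ := 2 * m - d with hsdef
  have hr1 : 1 ≤ Real.sqrt (d + 1) / Real.sqrt d := by
    rw [one_le_div (by positivity)]
    exact Real.sqrt_le_sqrt (by linarith)
  have hr2 : Real.sqrt (d + 1) / Real.sqrt d ≤ 1 + 1 / (2 * d) := by
    refine (abs_le_of_sq_le_sq' ?_ (by positivity)).2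
    rw [div_pow, hx2, hy2, ← sub_nonneg]
    field_simp
    ring_nf
    norm_num
  have h2 := stdNormalMass_mul_sub_le (z := s / Real.sqrt (d + 1))
    (div_nonneg (by linarith) hy.le) hr1
  rw [show Real.sqrt (d + 1) / Real.sqrt d * (s / Real.sqrt (d + 1)) = s / Real.sqrt d by
    field_simp] at h2
  have h3 := stdNormalMass_sub_le_div (x := (s - 1) / Real.sqrt (d + 1))
    (y := s / Real.sqrt (d + 1)) (by gcongr; linarith)
  rw [← sub_div, sub_sub_cancel] at h3
  have h4 : 0.7072 * (Real.sqrt (d + 1) / Real.sqrt d - 1) / Real.sqrt (2 * Real.pi)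
      ≤ 0.1411 / d := by
    rw [div_le_iff₀ (by positivity)]
    calc 0.7072 * (Real.sqrt (d + 1) / Real.sqrt d - 1) ≤ 0.7072 * (1 / (2 * d)) := by linarith
      _ ≤ 0.1411 / d * 2.5066 := by
        rw [← sub_nonneg]
        field_simp
        norm_num
      _ ≤ _ := by gcongr
  have h5 := error_term_le (c := 0.1411) (d := d) (by linarith) (by
    nlinarith [mul_nonneg (sub_nonneg.2 hx) (sq_nonneg (Real.sqrt d - 1)),
      sq_nonneg (Real.sqrt d - 1)])
  have h6 : cellBound d m = stdNormalMass ((s - 1) / Real.sqrt (d + 1)) := rfl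
  linarith

lemma binomTail_le_one {d m : ℕ} (hm : m ≤ d + 1) : binomTail d m ≤ 1 := by
  have h := sum_range_add_binomTail hm
  have : 0 ≤ ∑ j ∈ Finset.range m, binomProb d j :=
    Finset.sum_nonneg fun j _ => binomProb_nonneg d j
  linarith

lemma binomTail_le_of_le_four {d m : ℕ} (hd : 1 ≤ d) (hd4 : d ≤ 4) (hdm : 2 * m ≤ d) :
    binomTail d m
      ≤ 1 / 2 + stdNormalMass ((d - 2 * m) / Real.sqrt d) + 0.4748 / Real.sqrt d := by
  have hs := sqrt_two_pi_le
  have hs0 : 0 < Real.sqrt (2 * Real.pi) := by positivity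
  have hd' : (1 : ℝ) ≤ d := by exact_mod_cast hd
  have hx0 : 0 < Real.sqrt d := by positivity
  have hx2 : Real.sqrt (d : ℝ) ≤ 2 :=
    Real.sqrt_le_iff.2 ⟨by norm_num, by norm_num; exact_mod_cast hd4⟩
  have hq : 0.2374 ≤ 0.4748 / Real.sqrt d := by
    rw [le_div_iff₀ hx0]
    linarith
  rcases le_or_gt (Real.sqrt d) (d - 2 * m) with h | h
  · have h1 := le_stdNormalMass zero_le_one
    have h2 := stdNormalMass_strictMono.monotone ((one_le_div hx0).2 h)
    have h3 : 0.33 ≤ (1 - (1 : ℝ) ^ 3 / 6) / Real.sqrt (2 * Real.pi) := by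
      rw [le_div_iff₀ hs0]
      linarith
    have h4 := binomTail_le_one (d := d) (m := m) (by omega)
    linarith
  have h0 : 0 ≤ stdNormalMass ((d - 2 * m) / Real.sqrt d) :=
    stdNormalMass_nonneg (div_nonneg (by rw [sub_nonneg]; exact_mod_cast hdm) hx0.le)
  have hlt : ((d : ℝ) - 2 * m) ^ 2 < d := by
    have : (0 : ℝ) ≤ d - 2 * m := by rw [sub_nonneg]; exact_mod_cast hdm
    nlinarith [Real.sq_sqrt (show (0 : ℝ) ≤ d by positivity)]
  have hm2 : m ≤ 2 := by omega
  interval_cases d <;> interval_cases m <;> first | omega | (norm_num at hlt; done) | skip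
  · have : binomTail 2 1 = 3 / 4 := by
      norm_num [binomTail, binomProb, Finset.sum_Ico_succ_top, Nat.choose]
    have h2 : 0.25 ≤ 0.4748 / Real.sqrt (2 : ℕ) := by
      rw [le_div_iff₀ hx0]
      have : Real.sqrt (2 : ℕ) ≤ 1.5 := Real.sqrt_le_iff.2 (by norm_num)
      linarith
    linarith
  · have : binomTail 3 1 = 7 / 8 := by
      norm_num [binomTail, binomProb, Finset.sum_Ico_succ_top, Nat.choose]
    have h3 : Real.sqrt (3 : ℕ) ≤ 1.74 := Real.sqrt_le_iff.2 (by norm_num)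
    have h4 : 0.27 ≤ 0.4748 / Real.sqrt (3 : ℕ) := by
      rw [le_div_iff₀ hx0]
      linarith
    have h5 : (0.57 : ℝ) ≤ ((3 : ℕ) - 2 * (1 : ℕ)) / Real.sqrt (3 : ℕ) := by
      rw [le_div_iff₀ hx0]
      norm_num at h3 ⊢
      linarith
    have h6 := stdNormalMass_strictMono.monotone h5
    have h7 := le_stdNormalMass (x := 0.57) (by norm_num)
    have h8 : 0.2 ≤ ((0.57 : ℝ) - 0.57 ^ 3 / 6) / Real.sqrt (2 * Real.pi) := by
      rw [le_div_iff₀ hs0]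
      linarith
    linarith
  · have : binomTail 4 2 = 11 / 16 := by
      norm_num [binomTail, binomProb, Finset.sum_Ico_succ_top, Nat.choose]
    linarith

lemma binomTail_le_of_five_le {d m : ℕ} (hd : 5 ≤ d) (hdm : 2 * m ≤ d) :
    binomTail d m
      ≤ 1 / 2 + stdNormalMass ((d - 2 * m) / Real.sqrt d) + 0.4748 / Real.sqrt d := by
  have hd' : (5 : ℝ) ≤ d := by exact_mod_cast hd
  have hdm' : (2 : ℝ) * m ≤ d := by exact_mod_cast hdm
  have hx : 2.236 ≤ Real.sqrt d := Real.le_sqrt_of_sq_le (by norm_num; linarith)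
  have hx2 : Real.sqrt d ^ 2 = d := Real.sq_sqrt (by positivity)
  have h1 := binomTail_le_half_add_mul_cellBound hdm (binomProb_center_le hd)
  have h2 : cellBound d (d + 1 - m) ≤ 1 / 2 := stdNormalMass_le_half _
  have h3 : (0.42 / d : ℝ) * cellBound d (d + 1 - m) ≤ 0.21 / d := by
    refine (mul_le_mul_of_nonneg_left h2 (by positivity)).trans_eq ?_
    ring
  have h4 : cellBound d (d + 1 - m) = stdNormalMass ((d - 2 * m + 1) / Real.sqrt (d + 1)) := by
    rw [cellBound, Nat.cast_sub (by omega)]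
    congr 2
    push_cast
    ring
  have h5 := stdNormalMass_sub_le_div (x := (d - 2 * m) / Real.sqrt (d + 1))
    (y := (d - 2 * m + 1) / Real.sqrt (d + 1)) (by gcongr; linarith)
  rw [← sub_div, add_sub_cancel_left] at h5
  have h6 : stdNormalMass ((d - 2 * m) / Real.sqrt (d + 1))
      ≤ stdNormalMass ((d - 2 * m) / Real.sqrt d) := by
    refine stdNormalMass_strictMono.monotone
      (div_le_div_of_nonneg_left (by linarith) (by positivity) ?_)
    exact Real.sqrt_le_sqrt (by linarith)
  have h7 := error_term_le (c := 0.21) (d := d) (by linarith) (by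
    nlinarith [mul_nonneg (sub_nonneg.2 hx) (sq_nonneg (Real.sqrt d - 1)),
      sq_nonneg (Real.sqrt d - 1)])
  linarith

/-- The upper half of the Berry–Esseen inequality for the symmetric binomial distribution, at its
atoms. -/
lemma binomTail_le {d m : ℕ} (hd : 1 ≤ d) (hm : m ≤ d + 1) :
    binomTail d m
      ≤ 1 / 2 - stdNormalMass ((2 * m - d) / Real.sqrt d) + 0.4748 / Real.sqrt d := by
  rcases lt_or_ge d (2 * m) with h | h
  · exact binomTail_le_of_lt hd hm h
  rw [show (2 * m - d : ℝ) / Real.sqrt d = -((d - 2 * m) / Real.sqrt d) by ring,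
    stdNormalMass_neg, sub_neg_eq_add]
  rcases le_or_gt d 4 with h4 | h4
  · exact binomTail_le_of_le_four hd h4 h
  · exact binomTail_le_of_five_le h4 h

/-- The tail bound at an arbitrary level, for any `k` at or above it. -/
lemma sum_ite_binomProb_le {d : ℕ} (hd : 1 ≤ d) {x : ℝ} {k : ℤ}
    (hk : (d : ℝ) / 2 + x * Real.sqrt d / 2 ≤ k) :
    ∑ j ∈ Finset.range (d + 1), (if k ≤ (j : ℤ) then binomProb d j else 0)
      ≤ 1 / 2 - stdNormalMass x + 0.4748 / Real.sqrt d := by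
  have hx0 : 0 < Real.sqrt (d : ℝ) := Real.sqrt_pos.2 (by exact_mod_cast hd)
  rcases lt_or_ge ((d : ℤ) + 1) k with hkd | hkd
  · rw [Finset.sum_eq_zero fun j hj => if_neg (by have := Finset.mem_range.1 hj; omega)]
    have := stdNormalMass_le_half x
    have : 0 ≤ 0.4748 / Real.sqrt (d : ℝ) := by positivity
    linarith
  have hm : k.toNat ≤ d + 1 := by omega
  have hsum : ∑ j ∈ Finset.range (d + 1), (if k ≤ (j : ℤ) then binomProb d j else 0)
      = binomTail d k.toNat := by
    rw [← Finset.sum_filter, binomTail]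
    refine Finset.sum_congr ?_ fun _ _ => rfl
    ext j
    simp only [Finset.mem_filter, Finset.mem_range, Finset.mem_Ico]
    omega
  rw [hsum]
  refine (binomTail_le hd hm).trans ?_
  have hle : x ≤ (2 * (k.toNat : ℝ) - d) / Real.sqrt d := by
    rw [le_div_iff₀ hx0]
    have : (k : ℝ) ≤ k.toNat := by exact_mod_cast Int.self_le_toNat k
    linarith
  have := stdNormalMass_strictMono.monotone hle
  linarith

/-- For `d ≥ 1` and reals `α ≤ β` with `β - α ≥ 2/√d`, setting
`a = ⌈d/2 + α√d/2⌉` and `b = ⌊d/2 + β√d/2⌋`, the normalized binomial tail sum satisfies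
`2^{-d}·Σ_{k=a}^{b} C(d,k) ≥ Φ(β) - Φ(α) - 2·C₀/√d` with `C₀ = 0.4748`. -/
theorem statement17 (d : ℕ) (hd : 1 ≤ d) (α β : ℝ) (hαβ : α ≤ β)
    (hgap : 2 / Real.sqrt d ≤ β - α)
    (a b : ℤ) (ha : a = ⌈(d : ℝ) / 2 + α * Real.sqrt d / 2⌉)
    (hb : b = ⌊(d : ℝ) / 2 + β * Real.sqrt d / 2⌋) :
    stdNormalCDF β - stdNormalCDF α - 2 * 0.4748 / Real.sqrt d
      ≤ (∑ k ∈ Finset.range (d + 1),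
            if a ≤ (k : ℤ) ∧ (k : ℤ) ≤ b then (d.choose k : ℝ) else 0) / 2 ^ d := by
  have hlow : (d : ℝ) / 2 + -α * Real.sqrt d / 2 ≤ ((d - a + 1 : ℤ) : ℝ) := by
    have := Int.ceil_lt_add_one ((d : ℝ) / 2 + α * Real.sqrt d / 2)
    rw [← ha] at this
    push_cast
    linarith
  have hhigh : (d : ℝ) / 2 + β * Real.sqrt d / 2 ≤ ((b + 1 : ℤ) : ℝ) := by
    have := Int.lt_floor_add_one ((d : ℝ) / 2 + β * Real.sqrt d / 2)
    rw [← hb] at this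
    push_cast
    linarith
  have h1 := sum_ite_binomProb_le hd hlow
  have h2 := sum_ite_binomProb_le hd hhigh
  rw [stdNormalMass_neg] at h1
  rw [← Finset.sum_range_reflect] at h1
  have h3 : (∑ k ∈ Finset.range (d + 1),
      if a ≤ (k : ℤ) ∧ (k : ℤ) ≤ b then (d.choose k : ℝ) else 0) / 2 ^ d
      = ∑ k ∈ Finset.range (d + 1),
        if a ≤ (k : ℤ) ∧ (k : ℤ) ≤ b then binomProb d k else 0 := by
    rw [Finset.sum_div]
    refine Finset.sum_congr rfl fun k _ => ?_
    rw [binomProb, ite_div, zero_div]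
  have h4 : 1 ≤ (∑ k ∈ Finset.range (d + 1),
        if a ≤ (k : ℤ) ∧ (k : ℤ) ≤ b then binomProb d k else 0)
      + (∑ k ∈ Finset.range (d + 1), if (d - a + 1 : ℤ) ≤ ((d + 1 - 1 - k : ℕ) : ℤ)
          then binomProb d (d + 1 - 1 - k) else 0)
      + ∑ k ∈ Finset.range (d + 1), if b + 1 ≤ (k : ℤ) then binomProb d k else 0 := by
    rw [← sum_binomProb d, ← Finset.sum_add_distrib, ← Finset.sum_add_distrib]
    refine Finset.sum_le_sum fun k hk => ?_
    have hk' := Finset.mem_range.1 hk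
    rw [Nat.add_sub_cancel, binomProb_symm (by omega)]
    have := binomProb_nonneg d k
    split_ifs <;> first | linarith | omega
  rw [h3, stdNormalCDF_sub, mul_div_assoc]
  linarith

end
end
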